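/- Let C₁ and C₂ be Cantor sets, Y = C₁ * C₂ their topological join, and ΣY the suspension of Y with suspension points n and p. Suppose Z is a subspace of ΣY and h : ΣZ → ΣY is a homeomorphism whose restriction to Z (identified with the image of Z × {1/2} in ΣZ) is the inclusion of Z into ΣY. Fix c₁ ∈ C₁ and c₂ ∈ C₂, and let D ⊆ ΣY be the union of the suspension arcs of ΣY through the points of the join arc in Y from c₁ to c₂. Then the intersection Z ∩ D is an arc (i.e., homeomorphic to the closed interval [0,1]), and its two endpoints lie on the suspension arcs of ΣY through c₁ and through c₂ respectively. -/

import Mathlib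

open Set Filter Topology

universe u

/-- The equivalence generating the unreduced suspension: collapse `W × {0}` to a point `n`
and `W × {1}` to a point `p`. -/
def suspRel (W : Type u) : W × unitInterval → W × unitInterval → Prop := fun a b =>
  a = b ∨ (a.2 = 0 ∧ b.2 = 0) ∨ (a.2 = 1 ∧ b.2 = 1)

/-- The unreduced suspension `ΣW` of `W`, as a quotient of `W × [0,1]`. -/
def Susp (W : Type u) : Type u := Quot (suspRel W)

instance (W : Type u) [TopologicalSpace W] : TopologicalSpace (Susp W) :=
  inferInstanceAs (TopologicalSpace (Quot (suspRel W)))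

/-- The image of `(w, t)` in the suspension. -/
def suspMk (W : Type u) [TopologicalSpace W] (w : W) (t : unitInterval) : Susp W :=
  Quot.mk _ (w, t)

/-- The set `{n, p}` of the two suspension points of `ΣW` (for `W` nonempty),
i.e. the image of `W × {0, 1}`. -/
def suspPoles (W : Type u) [TopologicalSpace W] : Set (Susp W) :=
  {z | ∃ w t, z = suspMk W w t ∧ (t = 0 ∨ t = 1)}

/-- The suspension arc of `ΣW` through `w ∈ W`: the image of `{w} × [0,1]`. -/
def suspArc (W : Type u) [TopologicalSpace W] (w : W) : Set (Susp W) :=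
  {z | ∃ t, z = suspMk W w t}

/-- The equivalence generating the topological join: identify `(a,b,0) ~ (a,b',0)` and
`(a,b,1) ~ (a',b,1)`. -/
def joinRel (C₁ C₂ : Type u) : C₁ × C₂ × unitInterval → C₁ × C₂ × unitInterval → Prop :=
  fun x y =>
    x = y ∨ (x.2.2 = 0 ∧ y.2.2 = 0 ∧ x.1 = y.1) ∨ (x.2.2 = 1 ∧ y.2.2 = 1 ∧ x.2.1 = y.2.1)

/-- The topological join `C₁ * C₂`, as a quotient of `C₁ × C₂ × [0,1]`. -/
def TopJoin (C₁ C₂ : Type u) : Type u := Quot (joinRel C₁ C₂)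

instance (C₁ C₂ : Type u) [TopologicalSpace C₁] [TopologicalSpace C₂] :
    TopologicalSpace (TopJoin C₁ C₂) :=
  inferInstanceAs (TopologicalSpace (Quot (joinRel C₁ C₂)))

/-- The image of `(a, b, t)` in the join. -/
def joinMk (C₁ C₂ : Type u) [TopologicalSpace C₁] [TopologicalSpace C₂]
    (a : C₁) (b : C₂) (t : unitInterval) : TopJoin C₁ C₂ := Quot.mk _ (a, b, t)

/-- The copy of `C₁` inside `C₁ * C₂`: the image of `C₁ × C₂ × {0}`. -/
def joinC1 (C₁ C₂ : Type u) [TopologicalSpace C₁] [TopologicalSpace C₂] :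
    Set (TopJoin C₁ C₂) := {y | ∃ a b, y = joinMk C₁ C₂ a b 0}

/-- The copy of `C₂` inside `C₁ * C₂`: the image of `C₁ × C₂ × {1}`. -/
def joinC2 (C₁ C₂ : Type u) [TopologicalSpace C₁] [TopologicalSpace C₂] :
    Set (TopJoin C₁ C₂) := {y | ∃ a b, y = joinMk C₁ C₂ a b 1}

/-- The join arc from `a ∈ C₁` to `b ∈ C₂`: the image of `{(a,b)} × [0,1]`. -/
def joinArc (C₁ C₂ : Type u) [TopologicalSpace C₁] [TopologicalSpace C₂]
    (a : C₁) (b : C₂) : Set (TopJoin C₁ C₂) := {y | ∃ t, y = joinMk C₁ C₂ a b t}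

/-- Along a continuous real function whose shifted cosine is nonnegative, the function cannot leave
the window of half-width `π / 2` in which it starts. -/
theorem abs_sub_le_pi_div_two_of_cos_nonneg {θ : ℝ → ℝ} (hθ : Continuous θ) (φ : ℝ) {a b : ℝ}
    (hcos : ∀ t ∈ uIcc a b, 0 ≤ Real.cos (θ t - φ)) (h0 : |θ a - φ| ≤ Real.pi / 2) :
    |θ b - φ| ≤ Real.pi / 2 := by
  by_contra! hb
  have hpi := Real.pi_pos
  obtain ⟨y, hy1, hy2, hy⟩ : ∃ y, Real.pi / 2 < |y| ∧ |y| < Real.pi ∧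
      y + φ ∈ uIcc (θ a) (θ b) := by
    rw [abs_le] at h0
    rcases lt_abs.1 hb with h | h
    · refine ⟨min (θ b - φ) (3 * Real.pi / 4), ?_, ?_, ?_⟩
      · rw [abs_of_pos] <;> grind
      · rw [abs_of_pos] <;> grind
      · rw [mem_uIcc]; left; constructor <;> grind
    · refine ⟨max (θ b - φ) (-(3 * Real.pi / 4)), ?_, ?_, ?_⟩
      · rw [abs_of_neg] <;> grind
      · rw [abs_of_neg] <;> grind
      · rw [mem_uIcc]; right; constructor <;> grind
  obtain ⟨t, ht, hty⟩ := intermediate_value_uIcc hθ.continuousOn hy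
  have := hcos t ht
  rw [hty, add_sub_cancel_right, ← Real.cos_abs] at this
  exact absurd (Real.cos_neg_of_pi_div_two_lt_of_lt hy1 (by linarith)) (by linarith)

/-- Two plane curves, one crossing from left to right of the other, and the other crossing from
below to above the first, meet. -/
theorem exists_eq_of_crossing {f g : ℝ → ℂ} (hf : Continuous f) (hg : Continuous g)
    (hl : ∀ t ∈ Icc (0 : ℝ) 1, (f 0).re ≤ (g t).re) (hr : ∀ t ∈ Icc (0 : ℝ) 1, (g t).re ≤ (f 1).re)
    (hb : ∀ s ∈ Icc (0 : ℝ) 1, (g 0).im ≤ (f s).im) (ht : ∀ s ∈ Icc (0 : ℝ) 1, (f s).im ≤ (g 1).im)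
    (hne : ∀ s t, f s ≠ g t) : False := by
  let F : C(ℝ × ℝ, ℂ) := ⟨fun p => f p.1 - g p.2, by fun_prop⟩
  have hF : ∀ p, F p ≠ 0 := fun p => sub_ne_zero.2 (hne _ _)
  obtain ⟨L, ⟨hL0, hL⟩, -⟩ := Complex.isCoveringMapOn_exp.existsUnique_continuousMap_lifts
    (A := ℝ × ℝ) F (a₀ := (0, 0)) (e₀ := Complex.log (F (0, 0))) (Complex.exp_log (hF _))
    (by simpa using fun a b => hF (a, b))
  have hexp : ∀ p, Complex.exp (L p) = F p := fun p => congrFun hL p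
  have hre : ∀ p, (F p).re = Real.exp (L p).re * Real.cos (L p).im := fun p => by
    rw [← hexp, Complex.exp_re]
  have him : ∀ p, (F p).im = Real.exp (L p).re * Real.sin (L p).im := fun p => by
    rw [← hexp, Complex.exp_im]
  have cos_nonneg : ∀ p, 0 ≤ (F p).re → 0 ≤ Real.cos (L p).im := fun p h =>
    nonneg_of_mul_nonneg_right (hre p ▸ h) (Real.exp_pos _)
  have cos_nonpos : ∀ p, (F p).re ≤ 0 → Real.cos (L p).im ≤ 0 := fun p h =>
    nonpos_of_mul_nonpos_right (hre p ▸ h) (Real.exp_pos _)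
  have sin_nonneg : ∀ p, 0 ≤ (F p).im → 0 ≤ Real.sin (L p).im := fun p h =>
    nonneg_of_mul_nonneg_right (him p ▸ h) (Real.exp_pos _)
  have sin_nonpos : ∀ p, (F p).im ≤ 0 → Real.sin (L p).im ≤ 0 := fun p h =>
    nonpos_of_mul_nonpos_right (him p ▸ h) (Real.exp_pos _)
  have hleft : ∀ t ∈ Icc (0 : ℝ) 1, (F (0, t)).re ≤ 0 := fun t h => by simpa [F] using hl t h
  have hright : ∀ t ∈ Icc (0 : ℝ) 1, 0 ≤ (F (1, t)).re := fun t h => by simpa [F] using hr t h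
  have hbot : ∀ s ∈ Icc (0 : ℝ) 1, 0 ≤ (F (s, 0)).im := fun s h => by simpa [F] using hb s h
  have htop : ∀ s ∈ Icc (0 : ℝ) 1, (F (s, 1)).im ≤ 0 := fun s h => by simpa [F] using ht s h
  have m0 : (0 : ℝ) ∈ Icc (0 : ℝ) 1 := by simp
  have m1 : (1 : ℝ) ∈ Icc (0 : ℝ) 1 := by simp
  have hpi := Real.pi_pos
  have a00 : |(L (0, 0)).im - Real.pi / 2| ≤ Real.pi / 2 := by
    rw [hL0, Complex.log_im, abs_le]
    have := Complex.arg_nonneg_iff.2 (hbot 0 m0)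
    have := Complex.arg_le_pi (F (0, 0))
    constructor <;> linarith
  have cos_add_pi : ∀ x, Real.cos (x - -Real.pi) = - Real.cos x := fun x => by
    rw [sub_neg_eq_add, Real.cos_add_pi]
  have cos_add_pi_div_two : ∀ x, Real.cos (x - -(Real.pi / 2)) = - Real.sin x := fun x => by
    rw [sub_neg_eq_add, Real.cos_add_pi_div_two]
  have u01 : uIcc (0 : ℝ) 1 = Icc 0 1 := uIcc_of_le zero_le_one
  have u10 : uIcc (1 : ℝ) 0 = Icc 0 1 := uIcc_of_ge zero_le_one
  have a10 := abs_sub_le_pi_div_two_of_cos_nonneg (θ := fun s => (L (s, 0)).im) (by fun_prop)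
    (Real.pi / 2) (a := 0) (b := 1) (fun s hs => by
      rw [Real.cos_sub_pi_div_two]; exact sin_nonneg _ (hbot s (u01 ▸ hs))) a00
  have a10' : |(L (1, 0)).im - 0| ≤ Real.pi / 2 := by
    have := cos_nonneg _ (hright 0 m0)
    rw [abs_le] at a10 ⊢
    by_contra hcon
    exact absurd (Real.cos_neg_of_pi_div_two_lt_of_lt (x := (L (1, 0)).im) (by grind)
      (by linarith)) (by linarith)
  have a11 := abs_sub_le_pi_div_two_of_cos_nonneg (θ := fun t => (L (1, t)).im) (by fun_prop)
    0 (a := 0) (b := 1) (fun t hs => by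
      rw [sub_zero]; exact cos_nonneg _ (hright t (u01 ▸ hs))) a10'
  have a11' : |(L (1, 1)).im - -(Real.pi / 2)| ≤ Real.pi / 2 := by
    have := sin_nonpos _ (htop 1 m1)
    rw [abs_le] at a11 ⊢
    by_contra hcon
    exact absurd (Real.sin_pos_of_pos_of_lt_pi (x := (L (1, 1)).im) (by grind) (by linarith))
      (by linarith)
  have a01 := abs_sub_le_pi_div_two_of_cos_nonneg (θ := fun s => (L (s, 1)).im) (by fun_prop)
    (-(Real.pi / 2)) (a := 1) (b := 0) (fun s hs => by
      rw [cos_add_pi_div_two, neg_nonneg]; exact sin_nonpos _ (htop s (u10 ▸ hs))) a11'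
  have a01' : |(L (0, 1)).im - -Real.pi| ≤ Real.pi / 2 := by
    have := cos_nonpos _ (hleft 1 m1)
    rw [abs_le] at a01 ⊢
    by_contra hcon
    exact absurd (Real.cos_pos_of_mem_Ioo (x := (L (0, 1)).im) ⟨by grind, by linarith⟩)
      (by linarith)
  have b00 := abs_sub_le_pi_div_two_of_cos_nonneg (θ := fun t => (L (0, t)).im) (by fun_prop)
    (-Real.pi) (a := 1) (b := 0) (fun t hs => by
      rw [cos_add_pi, neg_nonneg]; exact cos_nonpos _ (hleft t (u10 ▸ hs))) a01'
  rw [abs_le] at a00 b00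
  linarith

/-- The least height `c` such that `z` and `x` are joined by a path along which `u ≤ c`. -/
noncomputable def passHeight {A : Type*} [TopologicalSpace A] (u : A → ℝ) (z x : A) : ℝ :=
  sInf {c : ℝ | JoinedIn {y | u y ≤ c} z x}

section PassHeight

variable {A : Type*} [TopologicalSpace A] {u : A → ℝ} {z x y : A}

theorem bddBelow_passHeight_set (u : A → ℝ) (z x : A) :
    BddBelow {c : ℝ | JoinedIn {y | u y ≤ c} z x} :=
  ⟨u x, fun _ hc => hc.target_mem⟩

theorem nonempty_passHeight_set [PathConnectedSpace A] (hu : ∀ y, u y ≤ 1) (z x : A) :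
    {c : ℝ | JoinedIn {y | u y ≤ c} z x}.Nonempty :=
  ⟨1, by
    have : {y | u y ≤ 1} = univ := eq_univ_of_forall hu
    rw [mem_ofPred_eq, this, joinedIn_univ]
    exact PathConnectedSpace.joined z x⟩

theorem passHeight_le {c : ℝ} (h : JoinedIn {y | u y ≤ c} z x) : passHeight u z x ≤ c :=
  csInf_le (bddBelow_passHeight_set u z x) h

theorem le_passHeight [PathConnectedSpace A] (hu : ∀ y, u y ≤ 1) : u x ≤ passHeight u z x :=
  le_csInf (nonempty_passHeight_set hu z x) fun _ hc => hc.target_mem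

theorem passHeight_le_one [PathConnectedSpace A] (hu : ∀ y, u y ≤ 1) : passHeight u z x ≤ 1 := by
  refine passHeight_le ?_
  have : {y | u y ≤ 1} = univ := eq_univ_of_forall hu
  rw [this, joinedIn_univ]
  exact PathConnectedSpace.joined z x

theorem passHeight_le_add [PathConnectedSpace A] (hu : ∀ y, u y ≤ 1) {ε : ℝ}
    (h : JoinedIn {w | u w ≤ u x + ε} x y) (hε : 0 ≤ ε) :
    passHeight u z y ≤ passHeight u z x + ε := by
  rw [← sub_le_iff_le_add]
  refine le_csInf (nonempty_passHeight_set hu z x) fun c hc => ?_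
  rw [sub_le_iff_le_add]
  have hx : u x ≤ c := hc.target_mem
  refine passHeight_le ((hc.mono fun w hw => ?_).trans (h.mono fun w hw => ?_))
  · have : u w ≤ c := hw
    rw [mem_ofPred_eq]; linarith
  · have : u w ≤ u x + ε := hw
    rw [mem_ofPred_eq]; linarith

theorem continuous_passHeight [PathConnectedSpace A] [LocallyPathConnectedSpace A]
    (hc : Continuous u) (hu : ∀ y, u y ≤ 1) (z : A) : Continuous (passHeight u z) := by
  refine continuous_iff_continuousAt.2 fun x => Metric.tendsto_nhds.2 fun ε hε => ?_
  have hN : {w | |u w - u x| < ε / 4} ∈ 𝓝 x :=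
    (hc.continuousAt).eventually (Metric.ball_mem_nhds (u x) (by positivity : 0 < ε / 4))
  filter_upwards [pathComponentIn_mem_nhds hN] with y hy
  have hy : JoinedIn {w | |u w - u x| < ε / 4} x y := hy
  have hyx : |u y - u x| < ε / 4 := hy.target_mem
  have h1 := passHeight_le_add (z := z) (ε := ε / 2) hu (hy.mono fun w hw => by
    have : |u w - u x| < ε / 4 := hw
    rw [abs_lt] at this
    rw [mem_ofPred_eq]; linarith) (by positivity)
  have h2 := passHeight_le_add (z := z) (ε := ε / 2) hu (hy.symm.mono fun w hw => by
    have : |u w - u x| < ε / 4 := hw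
    rw [abs_lt] at this hyx
    rw [mem_ofPred_eq]; linarith) (by positivity)
  rw [Real.dist_eq, abs_lt]
  constructor <;> linarith

end PassHeight

theorem Path.joinedIn_image_Icc {A : Type*} [TopologicalSpace A] {a b : A} (γ : Path a b)
    (t : unitInterval) : JoinedIn (γ '' Icc 0 t) a (γ t) := by
  have hconn : IsPathConnected (γ.extend '' Icc (0 : ℝ) t) :=
    ((convex_Icc _ _).isPathConnected (nonempty_Icc.2 t.2.1)).image γ.continuous_extend
  have h := hconn.joinedIn _ ⟨0, ⟨le_rfl, t.2.1⟩, γ.extend_zero⟩ _ ⟨t, ⟨t.2.1, le_rfl⟩, rfl⟩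
  rw [γ.extend_apply t.2] at h
  refine h.mono ?_
  rintro _ ⟨s, hs, rfl⟩
  have hs' : s ∈ unitInterval := ⟨hs.1, hs.2.trans t.2.2⟩
  exact ⟨⟨s, hs'⟩, ⟨hs.1, hs.2⟩, (γ.extend_apply hs').symm⟩

/-- A path ending at `x` reaches one of `x`, `y` first. -/
theorem JoinedIn.compl_singleton_or {A : Type*} [TopologicalSpace A] [T1Space A] {a x y : A}
    (h : Joined a x) (hxy : x ≠ y) : JoinedIn {y}ᶜ a x ∨ JoinedIn {x}ᶜ a y := by
  obtain ⟨γ⟩ := h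
  let S : Set unitInterval := γ ⁻¹' {x, y}
  have hS : IsClosed S := (Set.toFinite {x, y}).isClosed.preimage γ.continuous
  have hne : S.Nonempty := ⟨1, by simp [S]⟩
  obtain ⟨t, htS, ht⟩ := hS.isCompact.exists_isLeast hne
  have key : ∀ p q, p ≠ q → ({x, y} : Set A) = {p, q} → γ t = p → JoinedIn {q}ᶜ a p := by
    intro p q hpq hS' hp
    have hsub : γ '' Icc 0 t ⊆ {q}ᶜ := by
      rintro _ ⟨s, hs, rfl⟩ hq
      have hsS : s ∈ S := by
        change γ s ∈ ({x, y} : Set A)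
        rw [hS', show γ s = q from hq]; simp
      have : s = t := le_antisymm hs.2 (ht hsS)
      exact hpq (by rw [← hp, ← this]; exact hq)
    exact hp ▸ (γ.joinedIn_image_Icc t).mono hsub
  rcases htS with h | h
  · exact Or.inl (key x y hxy rfl h)
  · exact Or.inr (key y x hxy.symm (pair_comm _ _) h)

/-- A path connected, locally path connected metrizable continuum is an arc as soon as every path
between two of its points is surjective. -/
theorem exists_homeomorph_unitInterval_of_not_joinedIn {A : Type*} [TopologicalSpace A]
    [CompactSpace A] [TopologicalSpace.MetrizableSpace A] [PathConnectedSpace A]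
    [LocallyPathConnectedSpace A] {z₁ z₂ : A} (hne : z₁ ≠ z₂)
    (hsep : ∀ x, ¬ JoinedIn {x}ᶜ z₁ z₂) :
    ∃ φ : unitInterval ≃ₜ A, φ 0 = z₁ ∧ φ 1 = z₂ := by
  let _ : MetricSpace A := TopologicalSpace.metrizableSpaceMetric A
  have : Nonempty A := ⟨z₁⟩
  let le : A → A → Prop := fun x y => ¬ JoinedIn {x}ᶜ z₁ y
  have le_total : ∀ x y, x ≠ y → le x y ∨ le y x := by
    intro x y hxy
    by_contra! hcon
    obtain ⟨h1, h2⟩ := hcon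
    simp only [le, not_not] at h1 h2
    rcases JoinedIn.compl_singleton_or (PathConnectedSpace.joined z₂ x) hxy with h | h
    · exact hsep y (h2.trans h.symm)
    · exact hsep x (h1.trans h.symm)
  have le_antisymm : ∀ x y, x ≠ y → le x y → ¬ le y x := by
    intro x y hxy h1 h2
    rcases JoinedIn.compl_singleton_or (PathConnectedSpace.joined z₁ x) hxy with h | h
    · exact h2 h
    · exact h1 h
  let d := TopologicalSpace.denseSeq A
  let u : ℕ → A → ℝ := fun k w => max 0 (1 - k.unpair.2 * dist w (d k.unpair.1))
  have hu0 : ∀ k w, 0 ≤ u k w := fun k w => le_max_left _ _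
  have hu1 : ∀ k w, u k w ≤ 1 := fun k w => max_le zero_le_one (by
    have : 0 ≤ k.unpair.2 * dist w (d k.unpair.1) := by positivity
    linarith)
  have huc : ∀ k, Continuous (u k) := fun k => by fun_prop
  have hp0 : ∀ k w, 0 ≤ passHeight (u k) z₁ w := fun k w => (hu0 k w).trans (le_passHeight (hu1 k))
  have hp1 : ∀ k w, passHeight (u k) z₁ w ≤ 1 := fun k w => passHeight_le_one (hu1 k)
  let F : ℕ → A → ℝ := fun k w => (1 / 2 : ℝ) ^ k * passHeight (u k) z₁ w
  have hFb : ∀ k w, ‖F k w‖ ≤ (1 / 2 : ℝ) ^ k := fun k w => by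
    have : 0 ≤ F k w := mul_nonneg (by positivity) (hp0 k w)
    rw [Real.norm_of_nonneg this]
    exact mul_le_of_le_one_right (by positivity) (hp1 k w)
  have hFs : ∀ w, Summable fun k => F k w := fun w =>
    Summable.of_norm_bounded summable_geometric_two (fun k => hFb k w)
  let f : A → ℝ := fun w => ∑' k, F k w
  have hfc : Continuous f := continuous_tsum
    (fun k => continuous_const.mul (continuous_passHeight (huc k) (hu1 k) z₁))
    summable_geometric_two hFb
  have hmono : ∀ x y, x ≠ y → le x y → f x < f y := by
    intro x y hxy hle
    have hle' : ∀ k, F k x ≤ F k y := by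
      intro k
      refine mul_le_mul_of_nonneg_left ?_ (by positivity)
      refine le_csInf (nonempty_passHeight_set (hu1 k) z₁ y) fun c hc => ?_
      refine passHeight_le ?_
      by_contra hcon
      obtain ⟨γ, hγ⟩ := hc
      refine hle ⟨γ, fun t ht => hcon ?_⟩
      exact ht ▸ (γ.joinedIn_image_Icc t).mono (image_subset_iff.2 fun s _ => hγ s)
    obtain ⟨γ, hγ⟩ : JoinedIn {y}ᶜ z₁ x := not_not.1 (le_antisymm x y hxy hle)
    have hcl : IsClosed (range γ) := (isCompact_range γ.continuous).isClosed
    have hy : y ∉ range γ := fun ⟨t, ht⟩ => hγ t ht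
    obtain ⟨ε, hε, hball⟩ := Metric.isOpen_iff.1 hcl.isOpen_compl y hy
    obtain ⟨m, hm⟩ := exists_nat_gt (2 / ε)
    have hm0 : (0 : ℝ) < m := lt_trans (by positivity) hm
    obtain ⟨n, hn⟩ := (TopologicalSpace.denseRange_denseSeq A).exists_dist_lt y
      (by positivity : (0 : ℝ) < 1 / m)
    have hk : ∀ w, u (Nat.pair n m) w = max 0 (1 - m * dist w (d n)) := fun w => by simp [u]
    have huy : 0 < u (Nat.pair n m) y := by
      rw [hk, lt_max_iff]; right
      rw [lt_div_iff₀ hm0] at hn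
      have : dist y (d n) * m < 1 := hn
      linarith
    refine Summable.tsum_lt_tsum (i := Nat.pair n m) hle' ?_ (hFs x) (hFs y)
    refine mul_lt_mul_of_pos_left ?_ (by positivity)
    refine lt_of_le_of_lt ?_ (huy.trans_le (le_passHeight (hu1 _)))
    refine passHeight_le ⟨γ, fun t => ?_⟩
    rw [mem_ofPred_eq, hk, max_le_iff]
    refine ⟨le_rfl, ?_⟩
    have h1 : ε ≤ dist (γ t) y := by
      by_contra! hcon
      exact hball hcon ⟨t, rfl⟩
    have h2 := dist_triangle (γ t) (d n) y
    have h3 : dist (d n) y < 1 / m := by rw [dist_comm]; exact hn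
    rw [div_lt_iff₀ hε] at hm
    rw [lt_div_iff₀ hm0] at h3
    nlinarith
  have hinj : Function.Injective f := by
    intro x y hxy
    by_contra hne
    rcases le_total x y hne with h | h
    · exact (hmono x y hne h).ne hxy
    · exact (hmono y x (Ne.symm hne) h).ne hxy.symm
  have hmin : ∀ x, f z₁ ≤ f x := fun x => by
    by_cases hx : z₁ = x
    · rw [hx]
    · exact (hmono z₁ x hx fun h => h.source_mem rfl).le
  have hmax : ∀ x, f x ≤ f z₂ := fun x => by
    by_cases hx : x = z₂
    · rw [hx]
    · exact (hmono x z₂ hx (hsep x)).le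
  have hlt : f z₁ < f z₂ := hmono z₁ z₂ hne (hsep z₁)
  let g : A → Icc (f z₁) (f z₂) := fun x => ⟨f x, hmin x, hmax x⟩
  have hg : Function.Bijective g := by
    refine ⟨fun x y h => hinj (congrArg Subtype.val h), fun ⟨c, hc⟩ => ?_⟩
    obtain ⟨x, -, hx⟩ := isPreconnected_univ.intermediate_value (mem_univ z₁) (mem_univ z₂)
      hfc.continuousOn hc
    exact ⟨x, Subtype.ext hx⟩
  have hgc : Continuous g := hfc.subtype_mk _
  let e : A ≃ₜ Icc (f z₁) (f z₂) :=
    Continuous.homeoOfEquivCompactToT2 (f := Equiv.ofBijective g hg) hgc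
  have he : ∀ x, ((e x : Icc (f z₁) (f z₂)) : ℝ) = f x := fun x => rfl
  refine ⟨(e.trans (iccHomeoI _ _ hlt)).symm, ?_, ?_⟩
  · rw [Homeomorph.symm_apply_eq]
    ext
    simp [he]
  · rw [Homeomorph.symm_apply_eq]
    ext
    have : f z₂ - f z₁ ≠ 0 := sub_ne_zero.2 hlt.ne'
    simp [he, this]

/-- A compact space embedded in the strip `[0,1] × (0,1)` as a retract whose fibres run from the
bottom to the top of the strip is an arc. -/
theorem exists_homeomorph_unitInterval_of_retract_strip {A : Type*} [TopologicalSpace A]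
    [CompactSpace A] {j : A → ℝ × ℝ} (hj : Continuous j)
    (hjS : ∀ a, j a ∈ Icc (0 : ℝ) 1 ×ˢ Ioo (0 : ℝ) 1) {r : ℝ × ℝ → A}
    (hr : ContinuousOn r (Icc (0 : ℝ) 1 ×ˢ Ioo (0 : ℝ) 1)) (hrj : ∀ a, r (j a) = a)
    (hfib : ∀ a, ∀ ε > 0, ∃ g : ℝ → ℝ × ℝ, Continuous g ∧
      (∀ t, g t ∈ Icc (0 : ℝ) 1 ×ˢ Ioo (0 : ℝ) 1) ∧ (∀ t, r (g t) = a) ∧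
      (g 0).2 ≤ ε ∧ 1 - ε ≤ (g 1).2)
    {z₁ z₂ : A} (hz₁ : (j z₁).1 = 0) (hz₂ : (j z₂).1 = 1) :
    ∃ φ : unitInterval ≃ₜ A, φ 0 = z₁ ∧ φ 1 = z₂ := by
  let S : Set (ℝ × ℝ) := Icc (0 : ℝ) 1 ×ˢ Ioo (0 : ℝ) 1
  have hjinj : Function.Injective j := Function.LeftInverse.injective hrj
  have : TopologicalSpace.MetrizableSpace A :=
    (hj.isClosedEmbedding hjinj).isEmbedding.metrizableSpace
  have hS : Convex ℝ S := (convex_Icc _ _).prod (convex_Ioo _ _)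
  have : LocallyPathConnectedSpace S := hS.locallyPathConnectedSpace
  have : PathConnectedSpace S :=
    isPathConnected_iff_pathConnectedSpace.1 (hS.isPathConnected ⟨j z₁, hjS z₁⟩)
  let r' : S → A := fun p => r p
  have hr' : Continuous r' := continuousOn_iff_continuous_domRestrict.1 hr
  let j' : A → S := fun a => ⟨j a, hjS a⟩
  have hj' : Continuous j' := hj.subtype_mk _
  have hquot : IsQuotientMap r' := IsQuotientMap.of_inverse hj' hr' (fun a => hrj a)
  have : LocallyPathConnectedSpace A := hquot.locallyPathConnectedSpace
  have : PathConnectedSpace A := hquot.surjective.pathConnectedSpace hr'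
  refine exists_homeomorph_unitInterval_of_not_joinedIn (fun h => ?_) fun x => ?_
  · rw [h, hz₂] at hz₁; exact one_ne_zero hz₁
  · rintro ⟨γ, hγ⟩
    have hγc : Continuous γ.extend := γ.continuous_extend
    obtain ⟨ε, hε, hε'⟩ : ∃ ε > 0, ∀ t, ε ≤ (j (γ t)).2 ∧ (j (γ t)).2 ≤ 1 - ε := by
      obtain ⟨t, ht⟩ := (isCompact_univ (X := unitInterval)).exists_isMinOn univ_nonempty
        (f := fun t => min (j (γ t)).2 (1 - (j (γ t)).2))
        (by fun_prop : Continuous _).continuousOn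
      refine ⟨min (j (γ t)).2 (1 - (j (γ t)).2), ?_, fun s => ?_⟩
      · have := (hjS (γ t)).2
        exact lt_min this.1 (by linarith [this.2])
      · have h1 := le_min_iff.1 (isMinOn_iff.1 ht.2 s (mem_univ s))
        exact ⟨h1.1, by linarith [h1.2]⟩
    obtain ⟨g, hg, hgS, hgr, hg0, hg1⟩ := hfib x ε hε
    let toC : ℝ × ℝ → ℂ := Complex.equivRealProdCLM.symm
    have htoC : Continuous toC := Complex.equivRealProdCLM.symm.continuous
    have hre : ∀ p, (toC p).re = p.1 := fun p => by simp [toC]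
    have him : ∀ p, (toC p).im = p.2 := fun p => by simp [toC]
    have hext : ∀ s, ∃ t, γ.extend s = γ t := fun s => ⟨projIcc 0 1 zero_le_one s, rfl⟩
    refine exists_eq_of_crossing (f := fun s => toC (j (γ.extend s))) (g := fun t => toC (g t))
      (by fun_prop) (by fun_prop) ?_ ?_ ?_ ?_ ?_
    · intro t _
      simp only [hre, Path.extend_zero, hz₁]
      exact (hgS t).1.1
    · intro t _
      simp only [hre, Path.extend_one, hz₂]
      exact (hgS t).1.2
    · intro s _
      obtain ⟨t, ht⟩ := hext s
      simp only [him, ht]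
      exact hg0.trans (hε' t).1
    · intro s _
      obtain ⟨t, ht⟩ := hext s
      simp only [him, ht]
      exact (hε' t).2.trans hg1
    · intro s t hst
      obtain ⟨t', ht'⟩ := hext s
      have hst : j (γ.extend s) = g t := Complex.equivRealProdCLM.symm.injective hst
      have := hgr t
      rw [← hst, hrj, ht'] at this
      exact hγ t' this

section Coordinates

variable {W : Type u}

theorem suspRel_equivalence (W : Type u) : Equivalence (suspRel W) where
  refl _ := Or.inl rfl
  symm {x y} h := by
    rcases h with h | h | h
    exacts [Or.inl h.symm, Or.inr (Or.inl ⟨h.2, h.1⟩), Or.inr (Or.inr ⟨h.2, h.1⟩)]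
  trans {x y z} h h' := by
    unfold suspRel at *
    have : (0 : unitInterval) ≠ 1 := zero_ne_one
    grind

theorem suspRel_of_mk_eq {p q : W × unitInterval} (h : Quot.mk (suspRel W) p = Quot.mk _ q) :
    suspRel W p q :=
  (suspRel_equivalence W).eqvGen_iff.1 (Quot.eqvGen_exact h)

/-- The base coordinate of a point of the suspension, meaningful away from the poles. -/
noncomputable def suspBase (x : Susp W) : W := (Quot.out x).1

/-- The height of a point of the suspension. -/
noncomputable def suspHeight (x : Susp W) : unitInterval := (Quot.out x).2

variable [TopologicalSpace W]

theorem suspMk_base_height (x : Susp W) : suspMk W (suspBase x) (suspHeight x) = x :=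
  Quot.out_eq x

@[simp]
theorem suspHeight_mk (w : W) (t : unitInterval) : suspHeight (suspMk W w t) = t := by
  have h := suspRel_of_mk_eq (Quot.out_eq (suspMk W w t))
  rcases h with h | h | h
  exacts [congrArg Prod.snd h, h.1.trans h.2.symm, h.1.trans h.2.symm]

theorem suspBase_mk (w : W) {t : unitInterval} (ht : t ∈ Ioo 0 1) :
    suspBase (suspMk W w t) = w := by
  have h := suspRel_of_mk_eq (Quot.out_eq (suspMk W w t))
  rcases h with h | h | h
  exacts [congrArg Prod.fst h, absurd h.2 ht.1.ne', absurd h.2 ht.2.ne]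

theorem suspMk_zero_eq (w w' : W) : suspMk W w 0 = suspMk W w' 0 :=
  Quot.sound (Or.inr (Or.inl ⟨rfl, rfl⟩))

theorem suspMk_one_eq (w w' : W) : suspMk W w 1 = suspMk W w' 1 :=
  Quot.sound (Or.inr (Or.inr ⟨rfl, rfl⟩))

theorem continuous_suspMk : Continuous fun p : W × unitInterval => suspMk W p.1 p.2 :=
  continuous_quot_mk

theorem isQuotientMap_suspMk : IsQuotientMap fun p : W × unitInterval => suspMk W p.1 p.2 :=
  isQuotientMap_quot_mk

theorem continuous_suspHeight : Continuous (suspHeight : Susp W → unitInterval) := by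
  refine isQuotientMap_suspMk.continuous_iff.2 ?_
  have : suspHeight ∘ (fun p : W × unitInterval => suspMk W p.1 p.2) = Prod.snd :=
    funext fun p => suspHeight_mk _ _
  rw [this]
  exact continuous_snd

theorem continuousOn_suspBase :
    ContinuousOn (suspBase : Susp W → W) {x | suspHeight x ∈ Ioo 0 1} := by
  refine (isQuotientMap_suspMk.continuousOn_isOpen_iff
    (isOpen_Ioo.preimage continuous_suspHeight)).2 ?_
  refine continuous_fst.continuousOn.congr fun p hp => ?_
  have hp : suspHeight (suspMk W p.1 p.2) ∈ Ioo 0 1 := hp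
  rw [suspHeight_mk] at hp
  exact suspBase_mk _ hp

instance [CompactSpace W] : CompactSpace (Susp W) :=
  inferInstanceAs (CompactSpace (Quot (suspRel W)))

end Coordinates

section JoinCoordinates

variable {C₁ C₂ : Type u}

theorem joinRel_equivalence (C₁ C₂ : Type u) : Equivalence (joinRel C₁ C₂) where
  refl _ := Or.inl rfl
  symm {x y} h := by
    unfold joinRel at *
    grind
  trans {x y z} h h' := by
    unfold joinRel at *
    have : (0 : unitInterval) ≠ 1 := zero_ne_one
    grind

theorem joinRel_of_mk_eq {p q : C₁ × C₂ × unitInterval}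
    (h : Quot.mk (joinRel C₁ C₂) p = Quot.mk _ q) : joinRel C₁ C₂ p q :=
  (joinRel_equivalence C₁ C₂).eqvGen_iff.1 (Quot.eqvGen_exact h)

/-- The first coordinate of a point of the join, meaningful away from the copy of `C₂`. -/
noncomputable def joinFst (y : TopJoin C₁ C₂) : C₁ := (Quot.out y).1

/-- The second coordinate of a point of the join, meaningful away from the copy of `C₁`. -/
noncomputable def joinSnd (y : TopJoin C₁ C₂) : C₂ := (Quot.out y).2.1

/-- The join parameter of a point of the join. -/
noncomputable def joinParam (y : TopJoin C₁ C₂) : unitInterval := (Quot.out y).2.2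

variable [TopologicalSpace C₁] [TopologicalSpace C₂]

theorem joinMk_coordinates (y : TopJoin C₁ C₂) :
    joinMk C₁ C₂ (joinFst y) (joinSnd y) (joinParam y) = y :=
  Quot.out_eq y

@[simp]
theorem joinParam_mk (a : C₁) (b : C₂) (s : unitInterval) :
    joinParam (joinMk C₁ C₂ a b s) = s := by
  have h := joinRel_of_mk_eq (Quot.out_eq (joinMk C₁ C₂ a b s))
  rcases h with h | h | h
  exacts [congrArg (fun p => p.2.2) h, h.1.trans h.2.1.symm, h.1.trans h.2.1.symm]

theorem joinFst_mk (a : C₁) (b : C₂) {s : unitInterval} (hs : s < 1) :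
    joinFst (joinMk C₁ C₂ a b s) = a := by
  have h := joinRel_of_mk_eq (Quot.out_eq (joinMk C₁ C₂ a b s))
  rcases h with h | h | h
  exacts [congrArg (fun p => p.1) h, h.2.2, absurd h.2.1 hs.ne]

theorem joinSnd_mk (a : C₁) (b : C₂) {s : unitInterval} (hs : 0 < s) :
    joinSnd (joinMk C₁ C₂ a b s) = b := by
  have h := joinRel_of_mk_eq (Quot.out_eq (joinMk C₁ C₂ a b s))
  rcases h with h | h | h
  exacts [congrArg (fun p => p.2.1) h, absurd h.2.1 hs.ne', h.2.2]

theorem joinMk_zero_eq (a : C₁) (b b' : C₂) : joinMk C₁ C₂ a b 0 = joinMk C₁ C₂ a b' 0 :=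
  Quot.sound (Or.inr (Or.inl ⟨rfl, rfl, rfl⟩))

theorem joinMk_one_eq (a a' : C₁) (b : C₂) : joinMk C₁ C₂ a b 1 = joinMk C₁ C₂ a' b 1 :=
  Quot.sound (Or.inr (Or.inr ⟨rfl, rfl, rfl⟩))

theorem isQuotientMap_joinMk :
    IsQuotientMap fun p : C₁ × C₂ × unitInterval => joinMk C₁ C₂ p.1 p.2.1 p.2.2 :=
  isQuotientMap_quot_mk

theorem continuous_joinMk :
    Continuous fun p : C₁ × C₂ × unitInterval => joinMk C₁ C₂ p.1 p.2.1 p.2.2 :=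
  isQuotientMap_joinMk.continuous

theorem continuous_joinParam : Continuous (joinParam : TopJoin C₁ C₂ → unitInterval) := by
  refine isQuotientMap_joinMk.continuous_iff.2 ?_
  have : joinParam ∘ (fun p : C₁ × C₂ × unitInterval => joinMk C₁ C₂ p.1 p.2.1 p.2.2) =
      fun p => p.2.2 := funext fun p => joinParam_mk _ _ _
  rw [this]
  fun_prop

theorem continuousOn_joinFst :
    ContinuousOn (joinFst : TopJoin C₁ C₂ → C₁) {y | joinParam y < 1} := by
  refine (isQuotientMap_joinMk.continuousOn_isOpen_iff
    (isOpen_Iio.preimage continuous_joinParam)).2 ?_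
  refine continuous_fst.continuousOn.congr fun p hp => ?_
  have hp : joinParam (joinMk C₁ C₂ p.1 p.2.1 p.2.2) < 1 := hp
  rw [joinParam_mk] at hp
  exact joinFst_mk _ _ hp

theorem continuousOn_joinSnd :
    ContinuousOn (joinSnd : TopJoin C₁ C₂ → C₂) {y | 0 < joinParam y} := by
  refine (isQuotientMap_joinMk.continuousOn_isOpen_iff
    (isOpen_Ioi.preimage continuous_joinParam)).2 ?_
  refine (continuous_fst.comp continuous_snd).continuousOn.congr fun p hp => ?_
  have hp : 0 < joinParam (joinMk C₁ C₂ p.1 p.2.1 p.2.2) := hp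
  rw [joinParam_mk] at hp
  exact joinSnd_mk _ _ hp

instance [CompactSpace C₁] [CompactSpace C₂] : CompactSpace (TopJoin C₁ C₂) :=
  inferInstanceAs (CompactSpace (Quot (joinRel C₁ C₂)))

end JoinCoordinates

section SuspendedJoin

variable {C₁ C₂ : Type u} [TopologicalSpace C₁] [TopologicalSpace C₂]

/-- The point of the suspended join with the given coordinates. -/
def sjMk (a : C₁) (b : C₂) (s t : unitInterval) : Susp (TopJoin C₁ C₂) :=
  suspMk _ (joinMk C₁ C₂ a b s) t

/-- The join parameter of a point of the suspended join, meaningful away from the poles. -/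
noncomputable def sjParam (x : Susp (TopJoin C₁ C₂)) : unitInterval := joinParam (suspBase x)

/-- The `C₁`-coordinate of a point of the suspended join. -/
noncomputable def sjFst (x : Susp (TopJoin C₁ C₂)) : C₁ := joinFst (suspBase x)

/-- The `C₂`-coordinate of a point of the suspended join. -/
noncomputable def sjSnd (x : Susp (TopJoin C₁ C₂)) : C₂ := joinSnd (suspBase x)

theorem sjMk_coordinates (x : Susp (TopJoin C₁ C₂)) :
    sjMk (sjFst x) (sjSnd x) (sjParam x) (suspHeight x) = x := by
  unfold sjMk sjFst sjSnd sjParam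
  rw [joinMk_coordinates, suspMk_base_height]

@[simp]
theorem suspHeight_sjMk (a : C₁) (b : C₂) (s t : unitInterval) :
    suspHeight (sjMk a b s t) = t := suspHeight_mk _ _

theorem sjParam_sjMk (a : C₁) (b : C₂) (s : unitInterval) {t : unitInterval} (ht : t ∈ Ioo 0 1) :
    sjParam (sjMk a b s t) = s := by
  unfold sjMk sjParam
  rw [suspBase_mk _ ht, joinParam_mk]

theorem sjFst_sjMk (a : C₁) (b : C₂) {s t : unitInterval} (hs : s < 1) (ht : t ∈ Ioo 0 1) :
    sjFst (sjMk a b s t) = a := by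
  unfold sjMk sjFst
  rw [suspBase_mk _ ht, joinFst_mk _ _ hs]

theorem sjSnd_sjMk (a : C₁) (b : C₂) {s t : unitInterval} (hs : 0 < s) (ht : t ∈ Ioo 0 1) :
    sjSnd (sjMk a b s t) = b := by
  unfold sjMk sjSnd
  rw [suspBase_mk _ ht, joinSnd_mk _ _ hs]

theorem continuous_sjMk :
    Continuous fun p : C₁ × C₂ × unitInterval × unitInterval => sjMk p.1 p.2.1 p.2.2.1 p.2.2.2 :=
  continuous_suspMk.comp ((continuous_joinMk.comp (f := fun p : C₁ × C₂ × unitInterval ×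
    unitInterval => (p.1, p.2.1, p.2.2.1)) (by fun_prop)).prodMk (by fun_prop))

theorem Continuous.sjMk {T : Type*} [TopologicalSpace T] {a : T → C₁} {b : T → C₂}
    {s t : T → unitInterval} (ha : Continuous a) (hb : Continuous b) (hs : Continuous s)
    (ht : Continuous t) : Continuous fun x => sjMk (a x) (b x) (s x) (t x) :=
  continuous_sjMk.comp (ha.prodMk (hb.prodMk (hs.prodMk ht)))

theorem continuousOn_sjParam :
    ContinuousOn (sjParam : Susp (TopJoin C₁ C₂) → _) {x | suspHeight x ∈ Ioo 0 1} :=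
  continuous_joinParam.comp_continuousOn continuousOn_suspBase

theorem continuousOn_sjFst :
    ContinuousOn (sjFst : Susp (TopJoin C₁ C₂) → C₁)
      {x | suspHeight x ∈ Ioo 0 1 ∧ sjParam x < 1} :=
  continuousOn_joinFst.comp (continuousOn_suspBase.mono fun _ hx => hx.1) fun _ hx => hx.2

theorem continuousOn_sjSnd :
    ContinuousOn (sjSnd : Susp (TopJoin C₁ C₂) → C₂)
      {x | suspHeight x ∈ Ioo 0 1 ∧ 0 < sjParam x} :=
  continuousOn_joinSnd.comp (continuousOn_suspBase.mono fun _ hx => hx.1) fun _ hx => hx.2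

theorem isOpen_sjParam_preimage {U : Set unitInterval} (hU : IsOpen U) :
    IsOpen {x : Susp (TopJoin C₁ C₂) | suspHeight x ∈ Ioo 0 1 ∧ sjParam x ∈ U} :=
  continuousOn_sjParam.isOpen_inter_preimage (isOpen_Ioo.preimage continuous_suspHeight) hU

end SuspendedJoin

section SurfacePoints

/-- A point such that the path component of some neighbourhood is covered by a continuous image of
the plane. -/
def IsSurfacePoint {X : Type*} [TopologicalSpace X] (x : X) : Prop :=
  ∃ N ∈ 𝓝 x, ∃ g : ℝ × ℝ → X, Continuous g ∧ ∀ y, JoinedIn N x y → y ∈ range g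

theorem IsSurfacePoint.map {X X' : Type*} [TopologicalSpace X] [TopologicalSpace X'] {x : X}
    (hx : IsSurfacePoint x) (e : X ≃ₜ X') : IsSurfacePoint (e x) := by
  obtain ⟨N, hN, g, hg, h⟩ := hx
  refine ⟨e.symm ⁻¹' N, e.symm.continuous.continuousAt (by simpa using hN), e ∘ g,
    e.continuous.comp hg, fun y hy => ?_⟩
  have hy' := (hy.map e.symm.continuous).mono (image_preimage_subset _ _)
  rw [e.symm_apply_apply] at hy'
  obtain ⟨p, hp⟩ := h _ hy'
  exact ⟨p, by simp [hp]⟩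

theorem isSurfacePoint_homeomorph_iff {X X' : Type*} [TopologicalSpace X] [TopologicalSpace X']
    (e : X ≃ₜ X') (x : X) : IsSurfacePoint (e x) ↔ IsSurfacePoint x :=
  ⟨fun h => by simpa using h.map e.symm, fun h => h.map e⟩

theorem exists_homeomorph_unitInterval_map {t t' : unitInterval} (ht : t ∈ Ioo 0 1)
    (ht' : t' ∈ Ioo 0 1) : ∃ ψ : unitInterval ≃ₜ unitInterval, ψ t = t' ∧ ψ 0 = 0 ∧ ψ 1 = 1 := by
  have h0 : (0 : ℝ) < t := ht.1
  have h1 : (t : ℝ) < 1 := ht.2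
  have h0' : (0 : ℝ) < t' := ht'.1
  have h1' : (t' : ℝ) < 1 := ht'.2
  let p := Real.logb t t'
  have hp : 0 < p := Real.logb_pos_of_base_lt_one h0 h1 h0' h1'
  have hmem : ∀ q : ℝ, 0 < q → ∀ x : unitInterval, (x : ℝ) ^ q ∈ unitInterval := fun q hq x =>
    ⟨Real.rpow_nonneg x.2.1 _, Real.rpow_le_one x.2.1 x.2.2 hq.le⟩
  have hcont : ∀ (q : ℝ) (hq : 0 < q),
      Continuous fun x : unitInterval => (⟨(x : ℝ) ^ q, hmem q hq x⟩ : unitInterval) := fun q hq =>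
    (continuous_subtype_val.rpow_const fun x => Or.inr hq.le).subtype_mk _
  have hp' : 0 < p⁻¹ := inv_pos.2 hp
  refine ⟨⟨⟨fun x => ⟨(x : ℝ) ^ p, hmem p hp x⟩, fun x => ⟨(x : ℝ) ^ p⁻¹, hmem _ hp' x⟩,
    fun x => ?_,
    fun x => ?_⟩, hcont p hp, hcont _ hp'⟩, ?_, ?_, ?_⟩
  · ext; exact Real.rpow_rpow_inv x.2.1 hp.ne'
  · ext; exact Real.rpow_inv_rpow x.2.1 hp.ne'
  · ext; exact Real.rpow_logb h0 h1.ne h0'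
  · ext; exact Real.zero_rpow hp.ne'
  · ext; exact Real.one_rpow _

variable {W : Type u} [TopologicalSpace W]

/-- The map of suspensions induced by an endpoint-preserving self-map of the interval. -/
def suspReparam (ψ : unitInterval → unitInterval) (h0 : ψ 0 = 0) (h1 : ψ 1 = 1) :
    Susp W → Susp W :=
  Quot.map (fun p => (p.1, ψ p.2)) fun p q h => by
    rcases h with h | h | h
    · exact Or.inl (by rw [h])
    · exact Or.inr (Or.inl ⟨by simp [h.1, h0], by simp [h.2, h0]⟩)
    · exact Or.inr (Or.inr ⟨by simp [h.1, h1], by simp [h.2, h1]⟩)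

theorem suspReparam_mk {ψ : unitInterval → unitInterval} (h0 : ψ 0 = 0) (h1 : ψ 1 = 1) (w : W)
    (t : unitInterval) : suspReparam ψ h0 h1 (suspMk W w t) = suspMk W w (ψ t) := rfl

theorem continuous_suspReparam {ψ : unitInterval → unitInterval} (hψ : Continuous ψ)
    (h0 : ψ 0 = 0) (h1 : ψ 1 = 1) : Continuous (suspReparam (W := W) ψ h0 h1) :=
  isQuotientMap_suspMk.continuous_iff.2
    (continuous_suspMk.comp (continuous_fst.prodMk (hψ.comp continuous_snd)))

theorem isSurfacePoint_suspMk_iff (w : W) {t t' : unitInterval} (ht : t ∈ Ioo 0 1)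
    (ht' : t' ∈ Ioo 0 1) : IsSurfacePoint (suspMk W w t') ↔ IsSurfacePoint (suspMk W w t) := by
  obtain ⟨ψ, hψ, h0, h1⟩ := exists_homeomorph_unitInterval_map ht ht'
  have h0' : ψ.symm 0 = 0 := by rw [ψ.symm_apply_eq, h0]
  have h1' : ψ.symm 1 = 1 := by rw [ψ.symm_apply_eq, h1]
  let e : Susp W ≃ₜ Susp W :=
    { toFun := suspReparam ψ h0 h1
      invFun := suspReparam ψ.symm h0' h1'
      left_inv := fun x => by
        rw [← suspMk_base_height x, suspReparam_mk, suspReparam_mk, ψ.symm_apply_apply]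
      right_inv := fun x => by
        rw [← suspMk_base_height x, suspReparam_mk, suspReparam_mk, ψ.apply_symm_apply]
      continuous_toFun := continuous_suspReparam ψ.continuous h0 h1
      continuous_invFun := continuous_suspReparam ψ.symm.continuous h0' h1' }
  have he : e (suspMk W w t) = suspMk W w t' := by
    rw [← hψ]; rfl
  rw [← he, isSurfacePoint_homeomorph_iff]

theorem countable_image_of_continuousOn {E Y : Type*} [TopologicalSpace E] [TopologicalSpace Y]
    [TopologicalSpace.SeparableSpace E] [LocallyConnectedSpace E] [TotallyDisconnectedSpace Y]
    {F : E → Y} {U : Set E} (hU : IsOpen U) (hF : ContinuousOn F U) : (F '' U).Countable := by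
  refine Set.PairwiseDisjoint.countable_of_isOpen (s := fun y => U ∩ F ⁻¹' {y}) ?_ ?_ ?_
  · intro y _ y' _ hne
    exact Set.disjoint_left.2 fun p hp hp' => hne (hp.2.symm.trans hp'.2)
  · intro y _
    refine isOpen_iff_mem_nhds.2 fun p hp => ?_
    filter_upwards [connectedComponentIn_mem_nhds (hU.mem_nhds hp.1)] with q hq
    refine ⟨connectedComponentIn_subset _ _ hq, ?_⟩
    exact ((isPreconnected_connectedComponentIn.image F
      (hF.mono (connectedComponentIn_subset _ _))).subsingleton ⟨q, hq, rfl⟩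
      ⟨p, mem_connectedComponentIn hp.1, rfl⟩).trans hp.2
  · rintro _ ⟨p, hp, rfl⟩
    exact ⟨p, hp, rfl⟩

end SurfacePoints

section SurfacePointsOfSuspendedJoin

variable {C₁ C₂ : Type u} [TopologicalSpace C₁] [TopologicalSpace C₂]

/-- The points of the suspended join lying neither on a suspension arc through `C₁` or `C₂`
nor at a pole. -/
def sjInterior (C₁ C₂ : Type u) [TopologicalSpace C₁] [TopologicalSpace C₂] :
    Set (Susp (TopJoin C₁ C₂)) :=
  {x | suspHeight x ∈ Ioo 0 1 ∧ sjParam x ∈ Ioo 0 1}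

theorem isOpen_sjInterior : IsOpen (sjInterior C₁ C₂) := isOpen_sjParam_preimage isOpen_Ioo

theorem continuousOn_sjFst_sjSnd :
    ContinuousOn (fun x => (sjFst x, sjSnd x)) (sjInterior C₁ C₂) :=
  (continuousOn_sjFst.mono fun _ hx => ⟨hx.1, hx.2.2⟩).prodMk
    (continuousOn_sjSnd.mono fun _ hx => ⟨hx.1, hx.2.1⟩)

variable [TotallyDisconnectedSpace C₁] [TotallyDisconnectedSpace C₂]

theorem isSurfacePoint_of_mem_sjInterior {x : Susp (TopJoin C₁ C₂)} (hx : x ∈ sjInterior C₁ C₂) :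
    IsSurfacePoint x := by
  refine ⟨_, isOpen_sjInterior.mem_nhds hx,
    fun p => sjMk (sjFst x) (sjSnd x) (projIcc 0 1 zero_le_one p.1) (projIcc 0 1 zero_le_one p.2),
    Continuous.sjMk continuous_const continuous_const (continuous_projIcc.comp continuous_fst)
      (continuous_projIcc.comp continuous_snd), ?_⟩
  rintro y ⟨γ, hγ⟩
  have h : (sjFst y, sjSnd y) = (sjFst x, sjSnd x) :=
    ((isPreconnected_range γ.continuous).image _ (continuousOn_sjFst_sjSnd.mono
      (range_subset_iff.2 hγ))).subsingleton ⟨y, ⟨1, γ.target⟩, rfl⟩ ⟨x, ⟨0, γ.source⟩, rfl⟩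
  refine ⟨(sjParam y, suspHeight y), ?_⟩
  rw [Prod.mk.injEq] at h
  simp only [projIcc_val, ← h.1, ← h.2]
  exact sjMk_coordinates y

theorem not_isSurfacePoint_of_pages {x : Susp (TopJoin C₁ C₂)} {ι : Type*} [Uncountable ι]
    {k : ι → C₁ × C₂} (hk : Function.Injective k) {ρ : ι → ℝ → Susp (TopJoin C₁ C₂)}
    (hρ : ∀ i, Continuous (ρ i)) (h0 : ∀ i, ρ i 0 = x)
    (hint : ∀ i, ∀ r ∈ Ioo (0 : ℝ) 1, ρ i r ∈ sjInterior C₁ C₂)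
    (hpage : ∀ i, ∀ r ∈ Ioo (0 : ℝ) 1, (sjFst (ρ i r), sjSnd (ρ i r)) = k i) :
    ¬ IsSurfacePoint x := by
  rintro ⟨N, hN, g, hg, h⟩
  have hcount : (((fun x => (sjFst x, sjSnd x)) ∘ g) '' (g ⁻¹' sjInterior C₁ C₂)).Countable :=
    countable_image_of_continuousOn (isOpen_sjInterior.preimage hg)
      (continuousOn_sjFst_sjSnd.comp hg.continuousOn fun _ hp => hp)
  refine not_countable (α := ι) (countable_univ_iff.1 ?_)
  have hrange : (range k).Countable := hcount.mono ?_
  · exact (hrange.preimage_of_injOn hk.injOn).mono fun i _ => mem_range_self (f := k) i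
  rintro _ ⟨i, rfl⟩
  have hN' : ρ i ⁻¹' N ∈ 𝓝 0 := (hρ i).continuousAt (by rwa [h0])
  obtain ⟨ε, hε, hball⟩ := Metric.mem_nhds_iff.1 hN'
  let r := min (ε / 2) (1 / 2)
  have hr : r ∈ Ioo (0 : ℝ) 1 :=
    ⟨lt_min (by positivity) (by norm_num), (min_le_right _ _).trans_lt (by norm_num)⟩
  have hconn : IsPathConnected (ρ i '' Icc 0 r) :=
    ((convex_Icc _ _).isPathConnected (nonempty_Icc.2 hr.1.le)).image (hρ i)
  have hj := hconn.joinedIn _ ⟨0, ⟨le_rfl, hr.1.le⟩, h0 i⟩ _ ⟨r, ⟨hr.1.le, le_rfl⟩, rfl⟩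
  obtain ⟨p, hp⟩ := h _ (hj.mono (by
    rintro _ ⟨s, hs, rfl⟩
    refine hball ?_
    rw [Metric.mem_ball, Real.dist_eq, sub_zero, abs_of_nonneg hs.1]
    have : r ≤ ε / 2 := min_le_left _ _
    linarith [hs.2]))
  refine ⟨p, ?_, ?_⟩
  · rw [mem_preimage, hp]
    exact hint i r hr
  · rw [Function.comp_apply, hp]
    exact hpage i r hr

theorem isSurfacePoint_iff [Uncountable C₁] [Uncountable C₂] (x : Susp (TopJoin C₁ C₂)) :
    IsSurfacePoint x ↔ x ∈ sjInterior C₁ C₂ := by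
  refine ⟨fun hx => ?_, isSurfacePoint_of_mem_sjInterior⟩
  have hproj : ∀ r ∈ Ioo (0 : ℝ) 1, projIcc (0 : ℝ) 1 zero_le_one r ∈ Ioo (0 : unitInterval) 1 := by
    intro r hr
    rw [projIcc_of_mem _ ⟨hr.1.le, hr.2.le⟩]
    exact ⟨hr.1, hr.2⟩
  have hsymm : ∀ t : unitInterval, t ∈ Ioo 0 1 → unitInterval.symm t ∈ Ioo 0 1 := by
    intro t ht
    exact ⟨unitInterval.symm_one ▸ unitInterval.strictAnti_symm ht.2,
      unitInterval.symm_zero ▸ unitInterval.strictAnti_symm ht.1⟩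
  have hcp : Continuous fun r : ℝ => projIcc (0 : ℝ) 1 zero_le_one r := continuous_projIcc
  have hcs : Continuous fun r : ℝ => unitInterval.symm (projIcc (0 : ℝ) 1 zero_le_one r) :=
    unitInterval.continuous_symm.comp hcp
  have hp0 : projIcc (0 : ℝ) 1 zero_le_one 0 = 0 := projIcc_left _
  have hk₁ : ∀ b : C₂, Function.Injective fun a : C₁ => (a, b) := fun b a a' h =>
    congrArg Prod.fst h
  have hk₂ : ∀ a : C₁, Function.Injective fun b : C₂ => (a, b) := fun a b b' h =>
    congrArg Prod.snd h
  have hcoord : ∀ (a : C₁) (b : C₂) (s t : unitInterval), s ∈ Ioo 0 1 → t ∈ Ioo 0 1 →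
      sjMk a b s t ∈ sjInterior C₁ C₂ ∧ (sjFst (sjMk a b s t), sjSnd (sjMk a b s t)) = (a, b) := by
    intro a b s t hs ht
    refine ⟨⟨by simpa using ht, by rwa [sjParam_sjMk _ _ _ ht]⟩, ?_⟩
    rw [sjFst_sjMk _ _ hs.2 ht, sjSnd_sjMk _ _ hs.1 ht]
  let half : unitInterval := ⟨1 / 2, by norm_num, by norm_num⟩
  have hhalf : half ∈ Ioo 0 1 := by
    constructor
    · change (0 : ℝ) < 1 / 2; norm_num
    · change (1 / 2 : ℝ) < 1; norm_num
  have hne : ∀ t : unitInterval, t ≠ 0 → t ≠ 1 → t ∈ Ioo 0 1 := fun t h0 h1 =>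
    ⟨lt_of_le_of_ne t.2.1 (Ne.symm h0), lt_of_le_of_ne t.2.2 h1⟩
  have hx' := sjMk_coordinates x
  have hht : suspHeight x ∈ Ioo 0 1 := by
    refine hne _ (fun h => ?_) fun h => ?_
    · refine not_isSurfacePoint_of_pages (hk₂ (sjFst x))
        (ρ := fun b r => sjMk (sjFst x) b half (projIcc 0 1 zero_le_one r))
        (fun b => by exact Continuous.sjMk continuous_const continuous_const continuous_const hcp)
        (fun b => ?_) (fun b r hr => (hcoord _ _ _ _ hhalf (hproj r hr)).1)
        (fun b r hr => (hcoord _ _ _ _ hhalf (hproj r hr)).2) hx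
      rw [hp0, ← hx', h]
      exact suspMk_zero_eq _ _
    · refine not_isSurfacePoint_of_pages (hk₂ (sjFst x))
        (ρ := fun b r => sjMk (sjFst x) b half (unitInterval.symm (projIcc 0 1 zero_le_one r)))
        (fun b => by exact Continuous.sjMk continuous_const continuous_const continuous_const hcs)
        (fun b => ?_) (fun b r hr => (hcoord _ _ _ _ hhalf (hsymm _ (hproj r hr))).1)
        (fun b r hr => (hcoord _ _ _ _ hhalf (hsymm _ (hproj r hr))).2) hx
      rw [hp0, ← hx', h, unitInterval.symm_zero]
      exact suspMk_one_eq _ _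
  refine ⟨hht, hne _ (fun h => ?_) fun h => ?_⟩
  · refine not_isSurfacePoint_of_pages (hk₂ (sjFst x))
      (ρ := fun b r => sjMk (sjFst x) b (projIcc 0 1 zero_le_one r) (suspHeight x))
      (fun b => by exact Continuous.sjMk continuous_const continuous_const hcp continuous_const)
      (fun b => ?_) (fun b r hr => (hcoord _ _ _ _ (hproj r hr) hht).1)
      (fun b r hr => (hcoord _ _ _ _ (hproj r hr) hht).2) hx
    conv_rhs => rw [← hx', h]
    rw [hp0]
    exact congrArg (suspMk _ · _) (joinMk_zero_eq _ _ _)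
  · refine not_isSurfacePoint_of_pages (hk₁ (sjSnd x))
      (ρ := fun a r => sjMk a (sjSnd x) (unitInterval.symm (projIcc 0 1 zero_le_one r))
        (suspHeight x))
      (fun b => by exact Continuous.sjMk continuous_const continuous_const hcs continuous_const)
      (fun b => ?_) (fun b r hr => (hcoord _ _ _ _ (hsymm _ (hproj r hr)) hht).1)
      (fun b r hr => (hcoord _ _ _ _ (hsymm _ (hproj r hr)) hht).2) hx
    conv_rhs => rw [← hx', h]
    rw [hp0, unitInterval.symm_zero]
    exact congrArg (suspMk _ · _) (joinMk_one_eq _ _ _)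

end SurfacePointsOfSuspendedJoin

section Poles

variable {W : Type u} [TopologicalSpace W]

theorem eq_zero_or_eq_one_of_notMem_Ioo {t : unitInterval} (ht : t ∉ Ioo 0 1) : t = 0 ∨ t = 1 := by
  by_contra! hne
  exact ht ⟨unitInterval.pos_iff_ne_zero.2 hne.1, unitInterval.lt_one_iff_ne_one.2 hne.2⟩

theorem suspMk_eq_of_notMem_Ioo (w w' : W) {t : unitInterval} (ht : t ∉ Ioo 0 1) :
    suspMk W w t = suspMk W w' t := by
  rcases eq_zero_or_eq_one_of_notMem_Ioo ht with rfl | rfl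
  exacts [suspMk_zero_eq w w', suspMk_one_eq w w']

theorem eq_of_suspHeight_eq {x y : Susp W} (hx : suspHeight x ∉ Ioo 0 1)
    (hxy : suspHeight x = suspHeight y) : x = y := by
  rw [← suspMk_base_height x, ← suspMk_base_height y, ← hxy]
  exact suspMk_eq_of_notMem_Ioo _ _ hx

theorem exists_isPreconnected_mem_nhds_pole [CompactSpace W] {x : Susp W}
    (hx : suspHeight x ∉ Ioo 0 1) {U : Set (Susp W)} (hU : U ∈ 𝓝 x) :
    ∃ V ∈ 𝓝 x, V ⊆ U ∧ IsPreconnected V := by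
  have hclosed : IsClosed (suspHeight '' (interior U)ᶜ) :=
    continuous_suspHeight.isClosedMap _ isOpen_interior.isClosed_compl
  have hN : (suspHeight '' (interior U)ᶜ)ᶜ ∈ 𝓝 (suspHeight x) := by
    refine hclosed.isOpen_compl.mem_nhds ?_
    rintro ⟨y, hy, hyx⟩
    exact hy (eq_of_suspHeight_eq hx hyx.symm ▸ mem_interior_iff_mem_nhds.2 hU)
  have hO := ordConnectedComponent_mem_nhds.2 hN
  set O := ordConnectedComponent (suspHeight '' (interior U)ᶜ)ᶜ (suspHeight x)
  refine ⟨suspHeight ⁻¹' O, continuous_suspHeight.continuousAt hO, fun y hy => ?_, ?_⟩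
  · by_contra hyU
    exact ordConnectedComponent_subset hy ⟨y, fun h => hyU (interior_subset h), rfl⟩
  · refine isPreconnected_of_forall x fun y hy => ?_
    have hcont : Continuous (suspMk W (suspBase y)) :=
      continuous_suspMk.comp (Continuous.prodMk_right (suspBase y))
    refine ⟨suspMk W (suspBase y) '' O, ?_, ⟨suspHeight x, mem_of_mem_nhds hO, ?_⟩,
      ⟨suspHeight y, hy, suspMk_base_height y⟩,
      (inferInstance : OrdConnected O).isPreconnected.image _ hcont.continuousOn⟩
    · rintro _ ⟨t, ht, rfl⟩
      simpa using ht
    · rw [suspMk_eq_of_notMem_Ioo _ (suspBase x) hx, suspMk_base_height]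

end Poles

section Sheets

variable {C₁ C₂ : Type u}

/-- Away from the poles, the points of the suspension of the join arc from `c₁` to `c₂`. -/
def OnSheet (c₁ : C₁) (c₂ : C₂) (x : Susp (TopJoin C₁ C₂)) : Prop :=
  (sjParam x < 1 → sjFst x = c₁) ∧ (0 < sjParam x → sjSnd x = c₂)

theorem sjParam_eq_zero_of_forall_onSheet [Nontrivial C₂] {c₁ : C₁} {x : Susp (TopJoin C₁ C₂)}
    (hx : ∀ b, OnSheet c₁ b x) : sjParam x = 0 := by
  obtain ⟨b, hb⟩ := exists_ne (sjSnd x)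
  by_contra h0
  exact hb ((hx b).2 (unitInterval.pos_iff_ne_zero.2 h0)).symm

theorem sjParam_eq_one_of_forall_onSheet [Nontrivial C₁] {c₂ : C₂} {x : Susp (TopJoin C₁ C₂)}
    (hx : ∀ a, OnSheet a c₂ x) : sjParam x = 1 := by
  obtain ⟨a, ha⟩ := exists_ne (sjFst x)
  by_contra h1
  exact ha ((hx a).1 (unitInterval.lt_one_iff_ne_one.2 h1)).symm

variable [TopologicalSpace C₁] [TopologicalSpace C₂]

theorem onSheet_sjMk (c₁ : C₁) (c₂ : C₂) (s : unitInterval) {t : unitInterval}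
    (ht : t ∈ Ioo 0 1) : OnSheet c₁ c₂ (sjMk c₁ c₂ s t) := by
  rw [OnSheet, sjParam_sjMk _ _ _ ht]
  exact ⟨fun hs => sjFst_sjMk _ _ hs ht, fun hs => sjSnd_sjMk _ _ hs ht⟩

theorem OnSheet.sjMk_eq {c₁ : C₁} {c₂ : C₂} {x : Susp (TopJoin C₁ C₂)} (hx : OnSheet c₁ c₂ x) :
    sjMk c₁ c₂ (sjParam x) (suspHeight x) = x := by
  conv_rhs => rw [← sjMk_coordinates x]
  refine congrArg (suspMk _ · _) ?_
  by_cases h0 : sjParam x = 0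
  · rw [hx.1 (h0 ▸ zero_lt_one), h0]
    exact joinMk_zero_eq _ _ _
  rw [hx.2 (unitInterval.pos_iff_ne_zero.2 h0)]
  by_cases h1 : sjParam x = 1
  · rw [h1]
    exact joinMk_one_eq _ _ _
  rw [hx.1 (unitInterval.lt_one_iff_ne_one.2 h1)]

theorem iUnion_suspArc_joinArc (c₁ : C₁) (c₂ : C₂) :
    ⋃ y ∈ joinArc C₁ C₂ c₁ c₂, suspArc (TopJoin C₁ C₂) y =
      range fun p : unitInterval × unitInterval => sjMk c₁ c₂ p.1 p.2 := by
  ext x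
  simp only [mem_iUnion, mem_range, Prod.exists]
  constructor
  · rintro ⟨_, ⟨s, rfl⟩, t, rfl⟩
    exact ⟨s, t, rfl⟩
  · rintro ⟨s, t, rfl⟩
    exact ⟨_, ⟨s, rfl⟩, t, rfl⟩

theorem mem_range_sjMk_iff {c₁ : C₁} {c₂ : C₂} {x : Susp (TopJoin C₁ C₂)}
    (hx : suspHeight x ∈ Ioo 0 1) :
    x ∈ range (fun p : unitInterval × unitInterval => sjMk c₁ c₂ p.1 p.2) ↔ OnSheet c₁ c₂ x := by
  constructor
  · rintro ⟨⟨s, t⟩, rfl⟩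
    exact onSheet_sjMk _ _ _ (by simpa using hx)
  · exact fun h => ⟨(sjParam x, suspHeight x), h.sjMk_eq⟩

theorem IsPreconnected.sjFst_eq [TotallyDisconnectedSpace C₁]
    {S : Set (Susp (TopJoin C₁ C₂))} (hS : IsPreconnected S)
    (hS' : ∀ x ∈ S, suspHeight x ∈ Ioo 0 1 ∧ sjParam x < 1) {x y : Susp (TopJoin C₁ C₂)}
    (hx : x ∈ S) (hy : y ∈ S) : sjFst x = sjFst y :=
  (hS.image _ (continuousOn_sjFst.mono hS')).subsingleton (mem_image_of_mem _ hx)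
    (mem_image_of_mem _ hy)

theorem IsPreconnected.sjSnd_eq [TotallyDisconnectedSpace C₂]
    {S : Set (Susp (TopJoin C₁ C₂))} (hS : IsPreconnected S)
    (hS' : ∀ x ∈ S, suspHeight x ∈ Ioo 0 1 ∧ 0 < sjParam x) {x y : Susp (TopJoin C₁ C₂)}
    (hx : x ∈ S) (hy : y ∈ S) : sjSnd x = sjSnd y :=
  (hS.image _ (continuousOn_sjSnd.mono hS')).subsingleton (mem_image_of_mem _ hx)
    (mem_image_of_mem _ hy)

variable [TotallyDisconnectedSpace C₁] [TotallyDisconnectedSpace C₂]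

theorem OnSheet.of_isPreconnected {S : Set (Susp (TopJoin C₁ C₂))} (hS : IsPreconnected S)
    (hht : ∀ x ∈ S, suspHeight x ∈ Ioo 0 1)
    (hS' : ∀ x ∈ S, ∀ y ∈ S, sjParam x ∈ Ioo 0 1 → sjParam y ∈ Ioo 0 1)
    {c₁ : C₁} {c₂ : C₂} {x y : Susp (TopJoin C₁ C₂)} (hx : x ∈ S) (hy : y ∈ S)
    (h : OnSheet c₁ c₂ x) : OnSheet c₁ c₂ y := by
  by_cases hx' : sjParam x ∈ Ioo 0 1
  · have hall := fun z hz => hS' x hx z hz hx'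
    refine ⟨fun _ => ?_, fun _ => ?_⟩
    · rw [hS.sjFst_eq (fun z hz => ⟨hht z hz, (hall z hz).2⟩) hy hx, h.1 hx'.2]
    · rw [hS.sjSnd_eq (fun z hz => ⟨hht z hz, (hall z hz).1⟩) hy hx, h.2 hx'.1]
  have hnone : ∀ z ∈ S, sjParam z ∉ Ioo 0 1 := fun z hz hz' => hx' (hS' z hz x hx hz')
  have hconst : ∀ z ∈ S, sjParam z = sjParam x := by
    have hI := hS.image _ (continuousOn_sjParam.mono hht)
    let half : unitInterval := ⟨1 / 2, by norm_num, by norm_num⟩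
    have hhalf : half ∈ Ioo (0 : unitInterval) 1 :=
      ⟨by rw [← Subtype.coe_lt_coe]; norm_num [half], by rw [← Subtype.coe_lt_coe]; norm_num [half]⟩
    have key : ∀ z ∈ S, ∀ z' ∈ S, sjParam z = 0 → sjParam z' ≠ 1 := fun z hz z' hz' h0 h1 => by
      obtain ⟨w, hw, hw'⟩ := hI.Icc_subset ⟨z, hz, h0⟩ ⟨z', hz', h1⟩ ⟨hhalf.1.le, hhalf.2.le⟩
      exact hnone w hw (hw' ▸ hhalf)
    intro z hz
    rcases eq_zero_or_eq_one_of_notMem_Ioo (hnone z hz) with h0 | h1 <;>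
    rcases eq_zero_or_eq_one_of_notMem_Ioo (hnone x hx) with h0' | h1'
    · rw [h0, h0']
    · exact absurd h1' (key z hz x hx h0)
    · exact absurd h1 (key x hx z hz h0')
    · rw [h1, h1']
  rw [OnSheet, hconst y hy]
  refine ⟨fun hlt => ?_, fun hlt => ?_⟩
  · rw [hS.sjFst_eq (fun z hz => ⟨hht z hz, by rwa [hconst z hz]⟩) hy hx, h.1 hlt]
  · rw [hS.sjSnd_eq (fun z hz => ⟨hht z hz, by rwa [hconst z hz]⟩) hy hx, h.2 hlt]

theorem exists_nhds_not_isPreconnected (hC₁ : ∀ a : C₁, (𝓝[≠] a).NeBot)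
    (hC₂ : ∀ b : C₂, (𝓝[≠] b).NeBot) {x : Susp (TopJoin C₁ C₂)} (hx : suspHeight x ∈ Ioo 0 1) :
    ∃ U ∈ 𝓝 x, ∀ V ∈ 𝓝 x, V ⊆ U → ¬ IsPreconnected V := by
  rcases lt_or_ge (sjParam x) 1 with hs | hs
  · refine ⟨_, (isOpen_sjParam_preimage isOpen_Iio).mem_nhds ⟨hx, hs⟩, fun V hV hVU hconn => ?_⟩
    have hcont : Continuous fun a : C₁ => sjMk a (sjSnd x) (sjParam x) (suspHeight x) :=
      Continuous.sjMk continuous_id continuous_const continuous_const continuous_const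
    have hev : ∀ᶠ a in 𝓝[≠] sjFst x, sjMk a (sjSnd x) (sjParam x) (suspHeight x) ∈ V :=
      (hcont.continuousAt.mono_left nhdsWithin_le_nhds) (by simpa only [sjMk_coordinates] using hV)
    have := hC₁ (sjFst x)
    obtain ⟨a, haV, hne⟩ := (hev.and self_mem_nhdsWithin).exists
    refine hne (mem_singleton_iff.2 ?_)
    rw [← hconn.sjFst_eq hVU haV (mem_of_mem_nhds hV), sjFst_sjMk _ _ hs hx]
  · have hs : 0 < sjParam x := zero_lt_one.trans_le hs
    refine ⟨_, (isOpen_sjParam_preimage isOpen_Ioi).mem_nhds ⟨hx, hs⟩, fun V hV hVU hconn => ?_⟩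
    have hcont : Continuous fun b : C₂ => sjMk (sjFst x) b (sjParam x) (suspHeight x) :=
      Continuous.sjMk continuous_const continuous_id continuous_const continuous_const
    have hev : ∀ᶠ b in 𝓝[≠] sjSnd x, sjMk (sjFst x) b (sjParam x) (suspHeight x) ∈ V :=
      (hcont.continuousAt.mono_left nhdsWithin_le_nhds) (by simpa only [sjMk_coordinates] using hV)
    have := hC₂ (sjSnd x)
    obtain ⟨b, hbV, hne⟩ := (hev.and self_mem_nhdsWithin).exists
    refine hne (mem_singleton_iff.2 ?_)
    rw [← hconn.sjSnd_eq hVU hbV (mem_of_mem_nhds hV), sjSnd_sjMk _ _ hs hx]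

/-- A homeomorphism from a suspension onto a suspended join of perfect totally disconnected
spaces maps poles to poles. -/
theorem suspHeight_homeomorph_mem_Ioo_iff {W : Type u} [TopologicalSpace W] [CompactSpace W]
    (hC₁ : ∀ a : C₁, (𝓝[≠] a).NeBot) (hC₂ : ∀ b : C₂, (𝓝[≠] b).NeBot)
    (h : Susp W ≃ₜ Susp (TopJoin C₁ C₂)) (x : Susp W) :
    suspHeight (h x) ∈ Ioo 0 1 ↔ suspHeight x ∈ Ioo 0 1 := by
  have hpole : ∀ y : Susp W, suspHeight y ∉ Ioo 0 1 → suspHeight (h y) ∉ Ioo 0 1 := by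
    intro y hy hy'
    obtain ⟨U, hU, hU'⟩ := exists_nhds_not_isPreconnected hC₁ hC₂ hy'
    obtain ⟨V, hV, hVU, hconn⟩ :=
      exists_isPreconnected_mem_nhds_pole hy (h.continuous.continuousAt hU)
    exact hU' (h '' V) (h.isOpenMap.image_mem_nhds hV) (image_subset_iff.2 hVU)
      (hconn.image _ h.continuous.continuousOn)
  refine ⟨fun hx => not_not.1 fun hx' => hpole x hx' hx, fun hx => not_not.1 fun hx' => ?_⟩
  have h0 : (0 : unitInterval) ∉ Ioo 0 1 := fun h => h.1.ne rfl
  have h1 : (1 : unitInterval) ∉ Ioo 0 1 := fun h => h.2.ne rfl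
  have p0 := hpole (suspMk W (suspBase x) 0) (by rwa [suspHeight_mk])
  have p1 := hpole (suspMk W (suspBase x) 1) (by rwa [suspHeight_mk])
  have inj : ∀ y y' : Susp W, suspHeight y ≠ suspHeight y' → suspHeight (h y) ∉ Ioo 0 1 →
      suspHeight (h y) ≠ suspHeight (h y') := fun y y' hne hy heq =>
    hne (congrArg suspHeight (h.injective (eq_of_suspHeight_eq hy heq)))
  have n01 := inj (suspMk W (suspBase x) 0) (suspMk W (suspBase x) 1) (by simp) p0
  have n0 := inj x (suspMk W (suspBase x) 0) (by rw [suspHeight_mk]; exact hx.1.ne') hx'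
  have n1 := inj x (suspMk W (suspBase x) 1) (by rw [suspHeight_mk]; exact hx.2.ne) hx'
  have e0 := eq_zero_or_eq_one_of_notMem_Ioo p0
  have e1 := eq_zero_or_eq_one_of_notMem_Ioo p1
  have e := eq_zero_or_eq_one_of_notMem_Ioo hx'
  grind

end Sheets

section RestrictedHomeomorph

variable {C₁ C₂ : Type u} [TopologicalSpace C₁] [TopologicalSpace C₂]
  {Z : Set (Susp (TopJoin C₁ C₂))} {h : Susp Z ≃ₜ Susp (TopJoin C₁ C₂)} {m : unitInterval}

theorem isClosed_of_suspMk_eq (hZ : ∀ z : Z, h (suspMk Z z m) = z) :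
    IsClosed Z := by
  have hZeq : Z = h '' (suspHeight ⁻¹' {m}) := by
    ext x
    constructor
    · exact fun hx => ⟨_, suspHeight_mk ⟨x, hx⟩ m, hZ ⟨x, hx⟩⟩
    · rintro ⟨y, rfl, rfl⟩
      have hy := hZ (suspBase y)
      rw [suspMk_base_height] at hy
      exact hy ▸ (suspBase y).2
  rw [hZeq]
  exact h.isClosedMap _ (isClosed_singleton.preimage continuous_suspHeight)

theorem onSheet_iff_of_suspMk_eq [TotallyDisconnectedSpace C₁] [TotallyDisconnectedSpace C₂]
    [Uncountable C₁] [Uncountable C₂] (hm : m ∈ Ioo 0 1) (hZ : ∀ z : Z, h (suspMk Z z m) = z)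
    (hpole : ∀ x, suspHeight (h x) ∈ Ioo 0 1 ↔ suspHeight x ∈ Ioo 0 1) (c₁ : C₁) (c₂ : C₂)
    (z : Z) {t : unitInterval} (ht : t ∈ Ioo 0 1) :
    OnSheet c₁ c₂ (h (suspMk Z z t)) ↔ OnSheet c₁ c₂ (z : Susp (TopJoin C₁ C₂)) := by
  have hcont : Continuous fun t => h (suspMk Z z t) :=
    h.continuous.comp (continuous_suspMk.comp (Continuous.prodMk_right z))
  have hS : IsPreconnected ((fun t => h (suspMk Z z t)) '' Ioo 0 1) :=
    isPreconnected_Ioo.image _ hcont.continuousOn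
  have hht : ∀ x ∈ (fun t => h (suspMk Z z t)) '' Ioo 0 1, suspHeight x ∈ Ioo 0 1 := by
    rintro _ ⟨s, hs, rfl⟩
    rwa [hpole, suspHeight_mk]
  have hS' : ∀ x ∈ (fun t => h (suspMk Z z t)) '' Ioo 0 1,
      ∀ y ∈ (fun t => h (suspMk Z z t)) '' Ioo 0 1,
      sjParam x ∈ Ioo 0 1 → sjParam y ∈ Ioo 0 1 := by
    rintro _ ⟨s, hs, rfl⟩ _ ⟨s', hs', rfl⟩ hx
    have hx' := isSurfacePoint_of_mem_sjInterior ⟨hht _ (mem_image_of_mem _ hs), hx⟩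
    rw [isSurfacePoint_homeomorph_iff, isSurfacePoint_suspMk_iff z hs' hs,
      ← isSurfacePoint_homeomorph_iff h, isSurfacePoint_iff] at hx'
    exact hx'.2
  have hz : (z : Susp (TopJoin C₁ C₂)) ∈ (fun t => h (suspMk Z z t)) '' Ioo 0 1 :=
    ⟨m, hm, hZ z⟩
  exact ⟨OnSheet.of_isPreconnected hS hht hS' (mem_image_of_mem _ ht) hz,
    OnSheet.of_isPreconnected hS hht hS' hz (mem_image_of_mem _ ht)⟩

theorem exists_suspHeight_lt_and_lt
    (hpole : ∀ x, suspHeight (h x) ∈ Ioo 0 1 ↔ suspHeight x ∈ Ioo 0 1)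
    (z : Z) {ε : unitInterval} (hε : ε ∈ Ioo 0 1) :
    (∃ t ∈ Ioo 0 1, suspHeight (h (suspMk Z z t)) < ε) ∧
      ∃ t ∈ Ioo 0 1, ε < suspHeight (h (suspMk Z z t)) := by
  have hcont : Continuous fun t => suspHeight (h (suspMk Z z t)) :=
    continuous_suspHeight.comp
      (h.continuous.comp (continuous_suspMk.comp (Continuous.prodMk_right z)))
  have hdense : Dense (Ioo (0 : unitInterval) 1) := by
    rw [dense_iff_closure_eq, closure_Ioo zero_ne_one, eq_univ_iff_forall]
    exact fun t => ⟨unitInterval.nonneg', unitInterval.le_one'⟩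
  have hsurj : ∀ s : unitInterval, s ∉ Ioo 0 1 → ∃ t, suspHeight (h (suspMk Z z t)) = s := by
    intro s hs
    obtain ⟨x, hx⟩ := h.surjective (suspMk _ (suspBase (z : Susp (TopJoin C₁ C₂))) s)
    have hx' : suspHeight x ∉ Ioo 0 1 := by rwa [← hpole, hx, suspHeight_mk]
    exact ⟨suspHeight x, by
      rw [suspMk_eq_of_notMem_Ioo z (suspBase x) hx', suspMk_base_height, hx, suspHeight_mk]⟩
  constructor
  · obtain ⟨t, ht⟩ := hsurj 0 fun h0 => h0.1.ne rfl
    obtain ⟨t', ht', hlt⟩ := hdense.inter_open_nonempty _ (isOpen_Iio.preimage hcont)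
      ⟨t, ht.trans_lt hε.1⟩
    exact ⟨t', hlt, ht'⟩
  · obtain ⟨t, ht⟩ := hsurj 1 fun h1 => h1.2.ne rfl
    obtain ⟨t', ht', hlt⟩ := hdense.inter_open_nonempty _ (isOpen_Ioi.preimage hcont)
      ⟨t, hε.2.trans_eq ht.symm⟩
    exact ⟨t', hlt, ht'⟩

end RestrictedHomeomorph

theorem exists_continuous_mem_Ioo {t₀ t₁ : unitInterval} (h₀ : t₀ ∈ Ioo 0 1) (h₁ : t₁ ∈ Ioo 0 1) :
    ∃ γ : ℝ → unitInterval, Continuous γ ∧ (∀ r, γ r ∈ Ioo 0 1) ∧ γ 0 = t₀ ∧ γ 1 = t₁ := by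
  have hconn : IsPathConnected (Ioo (0 : ℝ) 1) :=
    (convex_Ioo _ _).isPathConnected (nonempty_Ioo.2 zero_lt_one)
  obtain ⟨γ, hγ⟩ := hconn.joinedIn (t₀ : ℝ) h₀ (t₁ : ℝ) h₁
  refine ⟨fun r => ⟨γ.extend r, ?_⟩, ?_, fun r => ?_, ?_, ?_⟩
  · exact Ioo_subset_Icc_self (hγ (projIcc 0 1 zero_le_one r))
  · exact γ.continuous_extend.subtype_mk _
  · exact hγ (projIcc 0 1 zero_le_one r)
  · exact Subtype.ext γ.extend_zero
  · exact Subtype.ext γ.extend_one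

theorem nhdsNE_neBot_nat_bool (f : ℕ → Bool) : (𝓝[≠] f).NeBot := by
  have hlim : Tendsto (fun n => Function.update f n (!f n)) atTop (𝓝 f) := by
    refine tendsto_pi_nhds.2 fun i => tendsto_nhds_of_eventually_eq ?_
    filter_upwards [eventually_gt_atTop i] with n hn
    exact Function.update_of_ne hn.ne _ _
  have hne : ∀ n, Function.update f n (!f n) ≠ f := fun n hn => by simpa using congrFun hn n
  exact (tendsto_nhdsWithin_iff.2 ⟨hlim, Eventually.of_forall hne⟩).neBot

theorem Homeomorph.nhdsNE_neBot_of_nat_bool {C : Type*} [TopologicalSpace C] (e : C ≃ₜ (ℕ → Bool))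
    (a : C) : (𝓝[≠] a).NeBot := by
  have := nhdsNE_neBot_nat_bool (e a)
  have hlim : Tendsto e.symm (𝓝[≠] (e a)) (𝓝[≠] a) := by
    refine tendsto_nhdsWithin_iff.2 ⟨?_, ?_⟩
    · exact (e.symm.continuous.tendsto' _ _ (e.symm_apply_apply a)).mono_left nhdsWithin_le_nhds
    · filter_upwards [self_mem_nhdsWithin] with f hf hf'
      exact hf ((e.symm_apply_eq).1 hf')
  exact hlim.neBot

theorem Homeomorph.uncountable_of_nat_bool {C : Type*} [TopologicalSpace C]
    (e : C ≃ₜ (ℕ → Bool)) : Uncountable C := by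
  rw [e.toEquiv.uncountable_iff, ← Cardinal.aleph0_lt_mk_iff]
  simp [Cardinal.aleph0_lt_continuum]

/-- With `Z ⊆ ΣY` and `h : ΣZ ≃ₜ ΣY` restricting to the inclusion on `Z`: for `c₁ ∈ C₁`,
`c₂ ∈ C₂`, let `D ⊆ ΣY` be the union of the suspension arcs through the points of the join
arc from `c₁` to `c₂`. Then `Z ∩ D` is an arc whose endpoints lie on the suspension arcs
through `c₁` and through `c₂` respectively. -/
theorem Z_meets_suspended_join_arc_in_arc (C₁ C₂ : Type u)
    [TopologicalSpace C₁] [TopologicalSpace C₂]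
    (e₁ : C₁ ≃ₜ (ℕ → Bool)) (e₂ : C₂ ≃ₜ (ℕ → Bool))
    (Z : Set (Susp (TopJoin C₁ C₂)))
    (h : Susp ↥Z ≃ₜ Susp (TopJoin C₁ C₂))
    (hrestr : ∀ z : Z, h (suspMk ↥Z z ⟨1/2, by norm_num [Set.mem_Icc]⟩) = ↑z)
    (c₁ : C₁) (c₂ : C₂)
    (D : Set (Susp (TopJoin C₁ C₂)))
    (hD : D = ⋃ y ∈ joinArc C₁ C₂ c₁ c₂, suspArc (TopJoin C₁ C₂) y) :
    ∃ φ : unitInterval ≃ₜ ↥(Z ∩ D),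
      (φ 0 : Susp (TopJoin C₁ C₂)) ∈ suspArc (TopJoin C₁ C₂) (joinMk C₁ C₂ c₁ c₂ 0) ∧
      (φ 1 : Susp (TopJoin C₁ C₂)) ∈ suspArc (TopJoin C₁ C₂) (joinMk C₁ C₂ c₁ c₂ 1) := by
  classical
  let m : unitInterval := ⟨1 / 2, by norm_num [Set.mem_Icc]⟩
  have hm : m ∈ Ioo (0 : unitInterval) 1 :=
    ⟨by rw [← Subtype.coe_lt_coe]; norm_num [m], by rw [← Subtype.coe_lt_coe]; norm_num [m]⟩
  have hZ : ∀ z : Z, h (suspMk Z z m) = z := hrestr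
  have _ : CompactSpace C₁ := e₁.symm.compactSpace
  have _ : CompactSpace C₂ := e₂.symm.compactSpace
  have _ : TotallyDisconnectedSpace C₁ := e₁.symm.totallyDisconnectedSpace
  have _ : TotallyDisconnectedSpace C₂ := e₂.symm.totallyDisconnectedSpace
  have _ : Uncountable C₁ := e₁.uncountable_of_nat_bool
  have _ : Uncountable C₂ := e₂.uncountable_of_nat_bool
  have hclosed : IsClosed Z := isClosed_of_suspMk_eq hZ
  have _ : CompactSpace Z := isCompact_iff_compactSpace.1 hclosed.isCompact
  have hpole := suspHeight_homeomorph_mem_Ioo_iff e₁.nhdsNE_neBot_of_nat_bool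
    e₂.nhdsNE_neBot_of_nat_bool h
  have hsheet := onSheet_iff_of_suspMk_eq hm hZ hpole
  have hZht : ∀ z ∈ Z, suspHeight z ∈ Ioo 0 1 := fun z hz => by
    have := hpole (suspMk Z ⟨z, hz⟩ m)
    rw [hZ, suspHeight_mk] at this
    exact this.2 hm
  let Φ : unitInterval × unitInterval → Susp (TopJoin C₁ C₂) := fun p => sjMk c₁ c₂ p.1 p.2
  have hΦ : Continuous Φ :=
    Continuous.sjMk continuous_const continuous_const continuous_fst continuous_snd
  have hD' : D = range Φ := hD.trans (iUnion_suspArc_joinArc c₁ c₂)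
  have hDiff : ∀ x, suspHeight x ∈ Ioo 0 1 → (x ∈ D ↔ OnSheet c₁ c₂ x) := fun x hx => by
    rw [hD']
    exact mem_range_sjMk_iff hx
  have hA : ∀ a : ↥(Z ∩ D), suspHeight (a : Susp (TopJoin C₁ C₂)) ∈ Ioo 0 1 :=
    fun a => hZht a a.2.1
  have hAsheet : ∀ a : ↥(Z ∩ D), OnSheet c₁ c₂ (a : Susp (TopJoin C₁ C₂)) :=
    fun a => (hDiff a (hA a)).1 a.2.2
  have _ : CompactSpace ↥(Z ∩ D) := by
    rw [← isCompact_iff_compactSpace, hD', ← image_preimage_eq_inter_range]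
    exact (hclosed.preimage hΦ).isCompact.image hΦ
  let j : ↥(Z ∩ D) → ℝ × ℝ := fun a => (sjParam (a : Susp (TopJoin C₁ C₂)),
    suspHeight (a : Susp (TopJoin C₁ C₂)))
  have hcoord : ContinuousOn (fun x : Susp (TopJoin C₁ C₂) =>
      ((sjParam x : ℝ), (suspHeight x : ℝ))) {x | suspHeight x ∈ Ioo 0 1} :=
    (continuous_subtype_val.comp_continuousOn continuousOn_sjParam).prodMk
      (continuous_subtype_val.comp continuous_suspHeight).continuousOn
  let ψ : ℝ × ℝ → Susp (TopJoin C₁ C₂) := fun p =>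
    Φ (projIcc 0 1 zero_le_one p.1, projIcc 0 1 zero_le_one p.2)
  have hψ : Continuous ψ := hΦ.comp
    ((continuous_projIcc.comp continuous_fst).prodMk (continuous_projIcc.comp continuous_snd))
  have hψcoord : ∀ x : Susp (TopJoin C₁ C₂), OnSheet c₁ c₂ x → ψ (sjParam x, suspHeight x) = x := by
    intro x hx
    simp only [ψ, Φ, projIcc_val]
    exact hx.sjMk_eq
  have hψht : ∀ p ∈ Icc (0 : ℝ) 1 ×ˢ Ioo (0 : ℝ) 1, suspHeight (ψ p) ∈ Ioo 0 1 := by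
    intro p hp
    simp only [ψ, Φ, suspHeight_sjMk, projIcc_of_mem zero_le_one (Ioo_subset_Icc_self hp.2)]
    exact hp.2
  have hψsymm : ∀ p ∈ Icc (0 : ℝ) 1 ×ˢ Ioo (0 : ℝ) 1, suspHeight (h.symm (ψ p)) ∈ Ioo 0 1 :=
    fun p hp => by rw [← hpole, h.apply_symm_apply]; exact hψht p hp
  let R : ℝ × ℝ → Susp (TopJoin C₁ C₂) := fun p => (suspBase (h.symm (ψ p)) : Z)
  have hR : ContinuousOn R (Icc (0 : ℝ) 1 ×ˢ Ioo (0 : ℝ) 1) :=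
    continuous_subtype_val.comp_continuousOn
      (continuousOn_suspBase.comp (h.symm.continuous.comp hψ).continuousOn hψsymm)
  have hRmem : ∀ p ∈ Icc (0 : ℝ) 1 ×ˢ Ioo (0 : ℝ) 1, R p ∈ Z ∩ D := by
    intro p hp
    refine ⟨Subtype.prop _, (hDiff _ (hZht _ (Subtype.prop _))).2 ?_⟩
    rw [← hsheet _ _ _ (hψsymm p hp), suspMk_base_height, h.apply_symm_apply]
    exact (hDiff _ (hψht p hp)).1 (hD' ▸ mem_range_self _)
  have hRh : ∀ (z : Z) (t : unitInterval), t ∈ Ioo 0 1 → ∀ p, ψ p = h (suspMk Z z t) →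
      R p = z := by
    intro z t ht p hp
    simp only [R, hp, h.symm_apply_apply, suspBase_mk z ht]
  have hhalf : ((1 : ℝ) / 2) ∈ Ioo (0 : ℝ) 1 := by norm_num
  let r : ℝ × ℝ → ↥(Z ∩ D) := fun p =>
    if hp : R p ∈ Z ∩ D then ⟨R p, hp⟩ else ⟨R (0, 1 / 2), hRmem _ ⟨by simp, hhalf⟩⟩
  have hrR : ∀ p ∈ Icc (0 : ℝ) 1 ×ˢ Ioo (0 : ℝ) 1, (r p : Susp (TopJoin C₁ C₂)) = R p := by
    intro p hp
    simp only [r, dif_pos (hRmem p hp)]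
  have hjS : ∀ a, j a ∈ Icc (0 : ℝ) 1 ×ˢ Ioo (0 : ℝ) 1 := fun a => ⟨Subtype.prop _, hA a⟩
  have hr : ∀ (z : Z) (t : unitInterval), t ∈ Ioo 0 1 → OnSheet c₁ c₂ (h (suspMk Z z t)) →
      ((r (sjParam (h (suspMk Z z t)), suspHeight (h (suspMk Z z t))) : ↥(Z ∩ D)) :
        Susp (TopJoin C₁ C₂)) = z := by
    intro z t ht hzt
    have hmem : suspHeight (h (suspMk Z z t)) ∈ Ioo 0 1 := by rwa [hpole, suspHeight_mk]
    exact (hrR (_, _) ⟨Subtype.prop _, hmem⟩).trans (hRh z t ht _ (hψcoord _ hzt))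
  have hline : ∀ s : unitInterval, ∃ a : ↥(Z ∩ D), ∀ c₁' c₂', OnSheet c₁' c₂' (Φ (s, m)) →
      OnSheet c₁' c₂' (a : Susp (TopJoin C₁ C₂)) := by
    intro s
    obtain ⟨x, hx⟩ := h.surjective (Φ (s, m))
    have hxht : suspHeight x ∈ Ioo 0 1 := by
      rw [← hpole, hx, suspHeight_sjMk]
      exact hm
    have hiff : ∀ c₁' c₂', OnSheet c₁' c₂' (Φ (s, m)) ↔
        OnSheet c₁' c₂' ((suspBase x : Z) : Susp (TopJoin C₁ C₂)) := fun c₁' c₂' => by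
      rw [← hsheet c₁' c₂' (suspBase x) hxht, suspMk_base_height, hx]
    refine ⟨⟨(suspBase x : Z), Subtype.prop _, ?_⟩, fun c₁' c₂' => (hiff c₁' c₂').1⟩
    exact (hDiff _ (hZht _ (Subtype.prop _))).2 ((hiff _ _).1 (onSheet_sjMk _ _ _ hm))
  obtain ⟨z₁, hz₁⟩ := hline 0
  obtain ⟨z₂, hz₂⟩ := hline 1
  replace hz₁ : sjParam (z₁ : Susp (TopJoin C₁ C₂)) = 0 :=
    sjParam_eq_zero_of_forall_onSheet fun b => hz₁ c₁ b (by
      simp only [Φ, sjMk]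
      rw [joinMk_zero_eq c₁ c₂ b]
      exact onSheet_sjMk _ _ _ hm)
  replace hz₂ : sjParam (z₂ : Susp (TopJoin C₁ C₂)) = 1 :=
    sjParam_eq_one_of_forall_onSheet fun a => hz₂ a c₂ (by
      simp only [Φ, sjMk]
      rw [joinMk_one_eq c₁ a c₂]
      exact onSheet_sjMk _ _ _ hm)
  obtain ⟨φ, hφ₁, hφ₂⟩ := exists_homeomorph_unitInterval_of_retract_strip (j := j) (r := r)
    (hcoord.comp_continuous continuous_subtype_val hA) hjS
    (IsInducing.subtypeVal.continuousOn_iff.2 (hR.congr hrR))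
    (fun a => Subtype.ext ((hrR _ (hjS a)).trans
      (hRh ⟨a, a.2.1⟩ m hm _ ((hψcoord a (hAsheet a)).trans (hZ ⟨a, a.2.1⟩).symm))))
    (fun a ε hε => by
      have hδ : min ε (1 / 2) ∈ Ioo (0 : ℝ) 1 :=
        ⟨lt_min hε (by norm_num), (min_le_right _ _).trans_lt (by norm_num)⟩
      obtain ⟨⟨t₀, ht₀, hlt₀⟩, -⟩ := exists_suspHeight_lt_and_lt hpole ⟨a, a.2.1⟩
        (ε := ⟨min ε (1 / 2), Ioo_subset_Icc_self hδ⟩) hδ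
      obtain ⟨-, t₁, ht₁, hlt₁⟩ := exists_suspHeight_lt_and_lt hpole ⟨a, a.2.1⟩
        (ε := unitInterval.symm ⟨min ε (1 / 2), Ioo_subset_Icc_self hδ⟩)
        ⟨sub_pos.2 hδ.2, sub_lt_self _ hδ.1⟩
      obtain ⟨γ, hγ, hγmem, rfl, rfl⟩ := exists_continuous_mem_Ioo ht₀ ht₁
      have hγht : ∀ t, suspHeight (h (suspMk Z ⟨a, a.2.1⟩ (γ t))) ∈ Ioo 0 1 := fun t => by
        rw [hpole, suspHeight_mk]
        exact hγmem t
      refine ⟨_, hcoord.comp_continuous (h.continuous.comp (continuous_suspMk.comp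
        ((Continuous.prodMk_right (⟨a, a.2.1⟩ : Z)).comp hγ))) hγht,
        fun t => ⟨Subtype.prop _, hγht t⟩,
        fun t => Subtype.ext (hr _ _ (hγmem t) ((hsheet _ _ _ (hγmem t)).2 (hAsheet a))), ?_, ?_⟩
      · exact (Subtype.coe_le_coe.2 hlt₀.le).trans (min_le_left _ _)
      · exact (sub_le_sub_left (min_le_left _ _) _).trans (Subtype.coe_le_coe.2 hlt₁.le))
    (z₁ := z₁) (z₂ := z₂) (congrArg Subtype.val hz₁) (congrArg Subtype.val hz₂)
  have hmem : ∀ (a : ↥(Z ∩ D)) (s : unitInterval), sjParam (a : Susp (TopJoin C₁ C₂)) = s →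
      (a : Susp (TopJoin C₁ C₂)) ∈ suspArc (TopJoin C₁ C₂) (joinMk C₁ C₂ c₁ c₂ s) := by
    rintro a _ rfl
    exact ⟨_, (hAsheet a).sjMk_eq.symm⟩
  exact ⟨φ, hφ₁ ▸ hmem z₁ 0 hz₁, hφ₂ ▸ hmem z₂ 1 hz₂⟩
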